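/- arXiv:1803.01739 — 9 statements merged into one kernel-verified Lean document; each statement's English description precedes it below -/
import Mathlib

section
/- Let p be a prime number, q = p^s and r = p^t with s, t ≥ 1. Let ℓ ≥ 1 be an integer and a_1, ..., a_ℓ ∈ F_q[T] with deg(a_i) > 0 for 1 ≤ i ≤ ℓ. Let P, Q ∈ F_q[T] with deg(Q) < deg(P) < r. Then there exists a unique infinite continued fraction α in F(q)^+ satisfying α = [a_1, a_2, ..., a_ℓ, α_{ℓ+1}] and α^r = P·α_{ℓ+1} + Q; moreover this α is the unique root in F(q)^+ of the algebraic equation y_ℓ·X^{r+1} − x_ℓ·X^r + (P·y_{ℓ−1} − Q·y_ℓ)·X − P·x_{ℓ−1} + Q·x_ℓ = 0. -/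
open Polynomial

noncomputable section

/-- The continuant of a finite word: `⟨∅⟩ = 1`, `⟨u₁⟩ = u₁`, and
`⟨u₁,…,uₘ⟩ = uₘ·⟨u₁,…,u_{m-1}⟩ + ⟨u₁,…,u_{m-2}⟩`. -/
def cont {R : Type*} [CommRing R] (l : List R) : R :=
  (l.foldl (fun q a => (a * q.1 + q.2, q.1)) ((1 : R), (0 : R))).1

/-- `x_n = ⟨a_1, …, a_n⟩`, with `x_0 = 1`. -/
def xCont {R : Type*} [CommRing R] (a : ℕ → R) (n : ℕ) : R :=
  cont ((List.range n).map fun i => a (i + 1))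

/-- `y_n = ⟨a_2, …, a_n⟩`, with `y_0 = 0` (and `y_1 = 1`). -/
def yCont {R : Type*} [CommRing R] (a : ℕ → R) (n : ℕ) : R :=
  if n = 0 then 0 else cont ((List.range (n - 1)).map fun i => a (i + 2))

/-- `1/T`, viewed in the field `F(q) = F_q((1/T))` of Laurent series in `1/T`. -/
def Tinv (K : Type*) [Field K] : LaurentSeries K := HahnSeries.single (-1 : ℤ) 1

/-- `α` is an infinite continued fraction in `F(q)⁺` whose first `ℓ` partial quotients are
`a 1, …, a ℓ`, whose full sequence of partial quotients is `b`, and whose sequence of complete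
quotients is `αs` (so `αs 1 = α` and `αs (n+1)` is the tail `α_{n+1}`);
moreover `α ^ r = P·α_{ℓ+1} + Q`. -/
def IsCFSol (Fq : Type*) [Field Fq] (r ℓ : ℕ) (a : ℕ → Polynomial Fq) (P Q : Polynomial Fq)
    (α : LaurentSeries Fq) : Prop :=
  α.order < 0 ∧
  ∃ (b : ℕ → Polynomial Fq) (αs : ℕ → LaurentSeries Fq),
    αs 1 = α ∧
    (∀ i, 1 ≤ i → i ≤ ℓ → b i = a i) ∧
    (∀ n, 1 ≤ n → 0 < (b n).degree ∧ (αs n).order < 0 ∧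
      αs n = aeval (Tinv Fq) (b n) + (αs (n + 1))⁻¹) ∧
    α ^ r = aeval (Tinv Fq) P * αs (ℓ + 1) + aeval (Tinv Fq) Q

namespace CFAux

variable {K : Type*} [Field K]

/-- All coefficients below `n` vanish. -/
def G (n : ℤ) (x : LaurentSeries K) : Prop := ∀ k, k < n → HahnSeries.coeff x k = 0

lemma G.mono {m n : ℤ} {x : LaurentSeries K} (h : G n x) (hmn : m ≤ n) : G m x :=
  fun k hk => h k (lt_of_lt_of_le hk hmn)

lemma G.add {n : ℤ} {x y : LaurentSeries K} (hx : G n x) (hy : G n y) : G n (x + y) :=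
  fun k hk => by rw [HahnSeries.coeff_add, hx k hk, hy k hk, add_zero]

lemma G.sub {n : ℤ} {x y : LaurentSeries K} (hx : G n x) (hy : G n y) : G n (x - y) :=
  fun k hk => by rw [HahnSeries.coeff_sub, hx k hk, hy k hk, sub_zero]

lemma G.mul {m n : ℤ} {x y : LaurentSeries K} (hx : G m x) (hy : G n y) : G (m + n) (x * y) := by
  intro k hk
  rw [HahnSeries.coeff_mul]
  apply Finset.sum_eq_zero
  intro ij hij
  have h := (Finset.mem_antidiagonal.1 hij).2.2
  by_cases h1 : ij.1 < m
  · rw [hx _ h1, zero_mul]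
  · rw [hy _ (by omega), mul_zero]

lemma G_zero (n : ℤ) : G n (0 : LaurentSeries K) := fun k _ => by simp

lemma G_one : G 0 (1 : LaurentSeries K) := fun k hk => by
  rw [HahnSeries.coeff_one, if_neg hk.ne]

lemma G.pow {n : ℤ} {x : LaurentSeries K} (hx : G n x) (r : ℕ) : G (r * n) (x ^ r) := by
  induction r with
  | zero => simpa using G_one
  | succ r ih =>
    rw [pow_succ]
    exact (ih.mul hx).mono (by push_cast; linarith)

lemma G_order (x : LaurentSeries K) : G x.order x :=
  fun _ hk => HahnSeries.coeff_eq_zero_of_lt_order hk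

lemma G.le_order {n : ℤ} {x : LaurentSeries K} (h : G n x) (hx : x ≠ 0) : n ≤ x.order :=
  (HahnSeries.le_order_iff_forall hx).2 h

lemma eq_zero_of_G {x : LaurentSeries K} (h : ∀ n : ℕ, G n x) : x = 0 := by
  ext k
  exact h (k + 1).toNat k (by omega)

lemma order_inv' {x : LaurentSeries K} (hx : x ≠ 0) : (x⁻¹).order = - x.order := by
  have h := HahnSeries.order_mul hx (inv_ne_zero hx)
  rw [mul_inv_cancel₀ hx, HahnSeries.order_one] at h
  omega

lemma ne_zero_of_order {x : LaurentSeries K} (h : x.order < 0) : x ≠ 0 := by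
  rintro rfl
  simp at h

lemma G_inv {x : LaurentSeries K} (h : x.order < 0) : G 1 x⁻¹ := by
  apply (G_order _).mono
  rw [order_inv' (ne_zero_of_order h)]
  omega

lemma order_inv_neg {x : LaurentSeries K} (h : G 1 x) (hx : x ≠ 0) : (x⁻¹).order < 0 := by
  have := h.le_order hx
  rw [order_inv' hx]
  omega

lemma one_sub {u : LaurentSeries K} (h : G 1 u) : 1 - u ≠ 0 ∧ G 0 (1 - u)⁻¹ := by
  have hc : HahnSeries.coeff (1 - u) 0 ≠ 0 := by
    rw [HahnSeries.coeff_sub, h 0 (by norm_num)]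
    simp
  have hne : 1 - u ≠ 0 := by
    intro h0
    rw [h0] at hc
    simp at hc
  refine ⟨hne, (G_order _).mono ?_⟩
  rw [order_inv' hne]
  have := HahnSeries.order_le_of_coeff_ne_zero hc
  omega

/-- Polynomials inside Laurent series. -/
abbrev ev (p : Polynomial K) : LaurentSeries K := aeval (Tinv K) p

lemma Tinv_pow (n : ℕ) : (Tinv K) ^ n = HahnSeries.single (-(n : ℤ)) 1 := by
  rw [Tinv, HahnSeries.single_pow]
  simp

lemma ev_monomial (n : ℕ) (c : K) : ev (monomial n c) = HahnSeries.single (-(n : ℤ)) c := by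
  rw [ev, aeval_monomial, Tinv_pow, HahnSeries.algebraMap_apply']
  simp

lemma ev_coeff (p : Polynomial K) (n : ℕ) : HahnSeries.coeff (ev p) (-(n : ℤ)) = p.coeff n := by
  induction p using Polynomial.induction_on' with
  | add p q hp hq => rw [ev, map_add, HahnSeries.coeff_add, coeff_add, ← hp, ← hq]
  | monomial m c =>
    rw [ev_monomial, HahnSeries.coeff_single, coeff_monomial]
    simp [eq_comm]

lemma ev_coeff_pos (p : Polynomial K) (k : ℤ) (hk : 0 < k) : HahnSeries.coeff (ev p) k = 0 := by
  induction p using Polynomial.induction_on' with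
  | add p q hp hq => rw [ev, map_add, HahnSeries.coeff_add, hp, hq, add_zero]
  | monomial m c =>
    rw [ev_monomial, HahnSeries.coeff_single, if_neg (by omega)]

lemma G_ev (p : Polynomial K) : G (-(p.natDegree : ℤ)) (ev p) := by
  intro k hk
  obtain ⟨n, rfl⟩ : ∃ n : ℕ, k = -(n : ℤ) := ⟨(-k).toNat, by omega⟩
  rw [ev_coeff]
  exact coeff_eq_zero_of_natDegree_lt (by omega)

lemma ev_injective : Function.Injective (ev : Polynomial K → LaurentSeries K) := by
  intro p q h
  ext n
  rw [← ev_coeff, ← ev_coeff, h]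

lemma ev_ne_zero {p : Polynomial K} (hp : p ≠ 0) : ev p ≠ 0 := by
  intro h
  exact hp (ev_injective (h.trans (map_zero (aeval (Tinv K))).symm))

lemma order_ev_add {p : Polynomial K} (hp : 0 < p.degree) {y : LaurentSeries K} (hy : G 1 y) :
    (ev p + y).order < 0 := by
  have hd : 0 < p.natDegree := natDegree_pos_iff_degree_pos.2 hp
  have : HahnSeries.coeff (ev p + y) (-(p.natDegree : ℤ)) ≠ 0 := by
    rw [HahnSeries.coeff_add, ev_coeff, hy _ (by omega), add_zero]
    intro h
    rw [coeff_natDegree, leadingCoeff_eq_zero] at h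
    simp [h] at hd
  have := HahnSeries.order_le_of_coeff_ne_zero this
  omega

lemma exists_poly_part (x : LaurentSeries K) : ∃ p : Polynomial K, G 1 (x - ev p) := by
  let N : ℕ := (-x.order).toNat
  refine ⟨∑ n ∈ Finset.range (N + 1), monomial n (HahnSeries.coeff x (-(n : ℤ))), ?_⟩
  intro k hk
  obtain ⟨n, rfl⟩ : ∃ n : ℕ, k = -(n : ℤ) := ⟨(-k).toNat, by omega⟩
  rw [HahnSeries.coeff_sub, ev_coeff, finsetSum_coeff]
  simp only [coeff_monomial, Finset.sum_ite_eq', Finset.mem_range]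
  split_ifs with h
  · simp
  · rw [HahnSeries.coeff_eq_zero_of_lt_order (by omega)]
    simp

lemma poly_part_degree {x : LaurentSeries K} (hx : x.order < 0) {p : Polynomial K}
    (h : G 1 (x - ev p)) : 0 < p.degree := by
  rw [← natDegree_pos_iff_degree_pos]
  by_contra hd
  have hx0 := ne_zero_of_order hx
  have : HahnSeries.coeff x x.order = 0 := by
    have h1 := h x.order (by omega)
    rw [HahnSeries.coeff_sub, G_ev p _ (by omega), sub_zero] at h1
    exact h1
  exact hx0 (HahnSeries.coeff_order_eq_zero.1 this)

lemma exists_limit (u : ℕ → LaurentSeries K) (h1 : ∀ n, G 1 (u n))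
    (h : ∀ n : ℕ, G n (u (n + 1) - u n)) : ∃ z, ∀ n : ℕ, G n (z - u n) := by
  have key : ∀ (k : ℤ) (m n : ℕ), m ≤ n → k < m →
      HahnSeries.coeff (u n) k = HahnSeries.coeff (u m) k := by
    intro k m n hmn hk
    induction n, hmn using Nat.le_induction with
    | base => rfl
    | succ n hmn ih =>
      have := h n k (by omega)
      rw [HahnSeries.coeff_sub, sub_eq_zero] at this
      rw [this, ih]
  let f : ℤ → K := fun k => HahnSeries.coeff (u (k + 1).toNat) k
  have hf : BddBelow (Function.support f) := by
    refine ⟨0, fun k hk => ?_⟩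
    by_contra hlt
    exact hk (h1 _ k (by omega))
  refine ⟨HahnSeries.ofSuppBddBelow f hf, fun n k hk => ?_⟩
  rw [HahnSeries.coeff_sub, HahnSeries.coeff_ofSuppBddBelow, sub_eq_zero]
  by_cases hk0 : k < 0
  · rw [h1 n k (by omega)]
    exact h1 _ k (by omega)
  · exact (key k _ n (by omega) (by omega)).symm

lemma exists_fixed (Φ : LaurentSeries K → LaurentSeries K) (h1 : ∀ z, G 1 z → G 1 (Φ z))
    (hc : ∀ z w (n : ℤ), G 1 z → G 1 w → G n (z - w) → G (n + 1) (Φ z - Φ w)) :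
    (∃ z, G 1 z ∧ Φ z = z) ∧ ∀ z w, G 1 z → G 1 w → Φ z = z → Φ w = w → z = w := by
  constructor
  · let u : ℕ → LaurentSeries K := fun n => Φ^[n] 0
    have hs : ∀ n, u (n + 1) = Φ (u n) := fun n => Function.iterate_succ_apply' _ _ _
    have hu : ∀ n, G 1 (u n) := by
      intro n
      induction n with
      | zero => exact G_zero 1
      | succ n ih => rw [hs]; exact h1 _ ih
    have hd : ∀ n : ℕ, G n (u (n + 1) - u n) := by
      intro n
      induction n with
      | zero => exact ((hu 1).sub (hu 0)).mono (by norm_num)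
      | succ n ih =>
        rw [hs (n + 1), hs n]
        push_cast
        have := hc _ _ _ (hu (n + 1)) (hu n) ih
        rwa [hs n] at this
    obtain ⟨z, hz⟩ := exists_limit u hu hd
    have hz1 : G 1 z := by
      have := ((hz 1).add (hu 1) : G _ _)
      simpa using this
    refine ⟨z, hz1, ?_⟩
    rw [← sub_eq_zero]
    apply eq_zero_of_G
    intro n
    have e : Φ z - z = (Φ z - Φ (u n)) - (z - u (n + 1)) := by rw [hs]; ring
    rw [e]
    exact ((hc _ _ _ hz1 (hu n) (hz n)).mono (by omega)).sub ((hz (n + 1)).mono (by push_cast; omega))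
  · intro z w hz hw ez ew
    rw [← sub_eq_zero]
    apply eq_zero_of_G
    intro n
    induction n with
    | zero => exact (hz.sub hw).mono (by norm_num)
    | succ n ih =>
      have := hc _ _ _ hz hw ih
      rw [ez, ew] at this
      exact_mod_cast this

/-- `Kf a n (1/γ)` is the inverse of `[a_1, …, a_n, γ]`. -/
def Kf (a : ℕ → Polynomial K) : ℕ → LaurentSeries K → LaurentSeries K
  | 0, y => y
  | n + 1, y => Kf a n (ev (a (n + 1)) + y)⁻¹

lemma Kf_G (a : ℕ → Polynomial K) (n : ℕ) (ha : ∀ i, 1 ≤ i → i ≤ n → 0 < (a i).degree)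
    (y : LaurentSeries K) (hy : G 1 y) : G 1 (Kf a n y) := by
  induction n generalizing y with
  | zero => exact hy
  | succ n ih =>
    exact ih (fun i h1 h2 => ha i h1 (by omega)) _
      (G_inv (order_ev_add (ha (n + 1) (by omega) le_rfl) hy))

lemma Kf_ne_zero (a : ℕ → Polynomial K) (n : ℕ) (ha : ∀ i, 1 ≤ i → i ≤ n → 0 < (a i).degree)
    (y : LaurentSeries K) (hy : G 1 y) (h0 : y ≠ 0 ∨ 1 ≤ n) : Kf a n y ≠ 0 := by
  induction n generalizing y with
  | zero => simpa [Kf] using h0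
  | succ n ih =>
    have := order_ev_add (ha (n + 1) (by omega) le_rfl) hy
    exact ih (fun i h1 h2 => ha i h1 (by omega)) _ (G_inv this)
      (Or.inl (inv_ne_zero (ne_zero_of_order this)))

lemma step_contr {p : Polynomial K} (hp : 0 < p.degree) {y z : LaurentSeries K} (hy : G 1 y)
    (hz : G 1 z) {m : ℤ} (h : G m (y - z)) : G (m + 1) ((ev p + y)⁻¹ - (ev p + z)⁻¹) := by
  have h1 := order_ev_add hp hy
  have h2 := order_ev_add hp hz
  have h1' := ne_zero_of_order h1
  have h2' := ne_zero_of_order h2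
  have e : (ev p + y)⁻¹ - (ev p + z)⁻¹ = 0 - (ev p + y)⁻¹ * (y - z) * (ev p + z)⁻¹ := by
    field_simp
    ring
  rw [e]
  exact (G_zero _).sub ((((G_inv h1).mul h).mul (G_inv h2)).mono (by omega))

lemma Kf_contr (a : ℕ → Polynomial K) (n : ℕ) (ha : ∀ i, 1 ≤ i → i ≤ n → 0 < (a i).degree)
    (y z : LaurentSeries K) (hy : G 1 y) (hz : G 1 z) (m : ℤ) (h : G m (y - z)) :
    G (m + n) (Kf a n y - Kf a n z) := by
  induction n generalizing y z m with
  | zero => simpa [Kf] using h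
  | succ n ih =>
    have hp := ha (n + 1) (by omega) le_rfl
    exact (ih (fun i h1 h2 => ha i h1 (by omega)) _ _ (G_inv (order_ev_add hp hy))
      (G_inv (order_ev_add hp hz)) _ (step_contr hp hy hz h)).mono (by push_cast; omega)

/-- `1/γ` as a function of `Z = 1/α`. -/
def hf (P Q : Polynomial K) (r : ℕ) (z : LaurentSeries K) : LaurentSeries K :=
  ev P * z ^ r * (1 - ev Q * z ^ r)⁻¹

lemma G_mul_pow {P : Polynomial K} {r : ℕ} (hP : P.natDegree < r) {z : LaurentSeries K}
    (hz : G 1 z) : G 1 (ev P * z ^ r) :=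
  ((G_ev P).mul (hz.pow r)).mono (by omega)

lemma hf_G {P Q : Polynomial K} {r : ℕ} (hP : P.natDegree < r) (hQ : Q.natDegree < r)
    {z : LaurentSeries K} (hz : G 1 z) : G 1 (hf P Q r z) :=
  ((G_mul_pow hP hz).mul (one_sub (G_mul_pow hQ hz)).2).mono (by omega)

lemma G_pow_sub {z w : LaurentSeries K} (hz : G 1 z) (hw : G 1 w) {m : ℤ} (h : G m (z - w))
    (r : ℕ) : G (m + r - 1) (z ^ r - w ^ r) := by
  induction r with
  | zero => simpa using G_zero _
  | succ r ih =>
    have e : z ^ (r + 1) - w ^ (r + 1) = z * (z ^ r - w ^ r) + (z - w) * w ^ r := by ring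
    rw [e]
    exact ((hz.mul ih).mono (by push_cast; omega)).add
      ((h.mul (hw.pow r)).mono (by push_cast; omega))

lemma alg_aux {F : Type*} [Field F] (P Q s t p q : F) (hp : p ≠ 0) (hq : q ≠ 0)
    (hp' : p = 1 - Q * s) (hq' : q = 1 - Q * t) :
    P * s * p⁻¹ - P * t * q⁻¹ = P * (s - t) * p⁻¹ * q⁻¹ := by
  field_simp
  rw [hp', hq']
  ring

lemma hf_contr {P Q : Polynomial K} {r : ℕ} (hP : P.natDegree < r) (hQ : Q.natDegree < r)
    {z w : LaurentSeries K} (hz : G 1 z) (hw : G 1 w) {m : ℤ} (h : G m (z - w)) :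
    G m (hf P Q r z - hf P Q r w) := by
  obtain ⟨h1, h2⟩ := one_sub (G_mul_pow hQ hz)
  obtain ⟨h3, h4⟩ := one_sub (G_mul_pow hQ hw)
  have e : hf P Q r z - hf P Q r w
      = ev P * (z ^ r - w ^ r) * (1 - ev Q * z ^ r)⁻¹ * (1 - ev Q * w ^ r)⁻¹ :=
    alg_aux _ _ _ _ _ _ h1 h3 rfl rfl
  rw [e]
  exact ((((G_ev P).mul (G_pow_sub hz hw h r)).mul h2).mul h4).mono (by omega)

lemma fixed (a : ℕ → Polynomial K) (n : ℕ) (hn : 1 ≤ n)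
    (ha : ∀ i, 1 ≤ i → i ≤ n → 0 < (a i).degree)
    {P Q : Polynomial K} {r : ℕ} (hP : P.natDegree < r) (hQ : Q.natDegree < r) :
    (∃ z, G 1 z ∧ Kf a n (hf P Q r z) = z) ∧ ∀ z w, G 1 z → G 1 w →
      Kf a n (hf P Q r z) = z → Kf a n (hf P Q r w) = w → z = w :=
  exists_fixed (fun z => Kf a n (hf P Q r z)) (fun z hz => Kf_G a n ha _ (hf_G hP hQ hz))
    (fun z w m hz hw h => (Kf_contr a n ha _ _ (hf_G hP hQ hz) (hf_G hP hQ hw) m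
      (hf_contr hP hQ hz hw h)).mono (by omega))

lemma hf_eq {P Q : Polynomial K} {r : ℕ} (hP0 : P ≠ 0) (hQ : Q.natDegree < r)
    {β : LaurentSeries K} (hβ : β.order < 0) :
    hf P Q r β⁻¹ = ((β ^ r - ev Q) / ev P)⁻¹ := by
  have h0 := ne_zero_of_order hβ
  have h1 := (one_sub (G_mul_pow hQ (G_inv hβ))).1
  have hP' := ev_ne_zero hP0
  have e : β ^ r - ev Q = β ^ r * (1 - ev Q * β⁻¹ ^ r) := by
    rw [inv_pow]
    field_simp
  rw [e]
  unfold hf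
  rw [inv_pow] at *
  field_simp

lemma gamma_order {P Q : Polynomial K} {r : ℕ} (hP0 : P ≠ 0) (hP : P.natDegree < r)
    (hQ : Q.natDegree < r)
    {β : LaurentSeries K} (hβ : β.order < 0) : ((β ^ r - ev Q) / ev P).order < 0 := by
  rw [← inv_inv ((β ^ r - ev Q) / ev P), ← hf_eq hP0 hQ hβ]
  apply order_inv_neg (hf_G hP hQ (G_inv hβ))
  have h0 := ne_zero_of_order hβ
  exact mul_ne_zero (mul_ne_zero (ev_ne_zero hP0) (pow_ne_zero _ (inv_ne_zero h0)))
    (inv_ne_zero (one_sub (G_mul_pow hQ (G_inv hβ))).1)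

section continuants

variable (a : ℕ → Polynomial K)

lemma foldl_pair (f : ℕ → Polynomial K) (n : ℕ) :
    ((List.range (n + 1)).map f).foldl (fun q a => (a * q.1 + q.2, q.1)) (1, 0)
      = (cont ((List.range (n + 1)).map f), cont ((List.range n).map f)) := by
  simp [cont, List.range_succ]

lemma cont_succ (f : ℕ → Polynomial K) (n : ℕ) :
    cont ((List.range (n + 2)).map f)
      = f (n + 1) * cont ((List.range (n + 1)).map f) + cont ((List.range n).map f) := by
  rw [cont, List.range_succ, List.map_append, List.foldl_append, foldl_pair]
  simp

lemma x_zero : xCont a 0 = 1 := by simp [xCont, cont]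
lemma x_one : xCont a 1 = a 1 := by simp [xCont, cont]
lemma x_succ (n : ℕ) : xCont a (n + 2) = a (n + 2) * xCont a (n + 1) + xCont a n :=
  cont_succ (fun i => a (i + 1)) n
lemma y_zero : yCont a 0 = 0 := by simp [yCont]
lemma y_one : yCont a 1 = 1 := by simp [yCont, cont]
lemma y_succ (n : ℕ) : yCont a (n + 2) = a (n + 2) * yCont a (n + 1) + yCont a n := by
  cases n with
  | zero => simp [yCont, cont]
  | succ n => exact cont_succ (fun i => a (i + 2)) n

lemma det_xy (n : ℕ) : (xCont a (n + 1) * yCont a n - xCont a n * yCont a (n + 1)) ^ 2 = 1 := by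
  induction n with
  | zero => simp [x_zero, y_zero, y_one]
  | succ n ih =>
    rw [x_succ, y_succ, ← ih]
    ring

lemma alg_base {F : Type*} [Field F] (c g : F) (hg : g ≠ 0) :
    (c + g⁻¹) * (1 * g + 0) = c * g + 1 := by
  field_simp
  ring

lemma alg_succ {F : Type*} [Field F] (M c g x x' y y' : F) (hg : g ≠ 0)
    (h : M * (y * (c + g⁻¹) + y') = x * (c + g⁻¹) + x') :
    M * ((c * y + y') * g + y) = (c * x + x') * g + x := by
  have h2 : g⁻¹ * g = 1 := inv_mul_cancel₀ hg
  linear_combination g * h + (x - M * y) * h2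

lemma ev_lin (c u v : Polynomial K) : ev (c * u + v) = ev c * ev u + ev v := by
  simp only [ev, map_add, map_mul]

lemma mobius (n : ℕ) (ha : ∀ i, 1 ≤ i → i ≤ n + 1 → 0 < (a i).degree) (γ : LaurentSeries K)
    (hγ : γ.order < 0) :
    (Kf a (n + 1) γ⁻¹)⁻¹ * (ev (yCont a (n + 1)) * γ + ev (yCont a n))
      = ev (xCont a (n + 1)) * γ + ev (xCont a n) := by
  have h0 := ne_zero_of_order hγ
  induction n generalizing γ with
  | zero =>
    have h1 : ev (1 : Polynomial K) = 1 := map_one _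
    have h2 : ev (0 : Polynomial K) = 0 := map_zero _
    rw [zero_add, x_one, x_zero, y_one, y_zero, Kf, Kf, inv_inv, h1, h2]
    exact alg_base _ _ h0
  | succ n ih =>
    have hδ := order_ev_add (ha (n + 2) (by omega) le_rfl) (G_inv hγ)
    have h := ih (fun i h1 h2 => ha i h1 (by omega)) _ hδ (ne_zero_of_order hδ)
    rw [x_succ, y_succ, ev_lin, ev_lin, Kf]
    exact alg_succ _ _ _ _ _ _ _ h0 h

lemma alg_root {F : Type*} [Field F] (M P Q g x x' y y' b : F) (hP : P ≠ 0)
    (hne : y * g + y' ≠ 0) (hm : M * (y * g + y') = x * g + x') :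
    y * ((P * g + Q) * b) - x * (P * g + Q) + (P * y' - Q * y) * b - P * x' + Q * x = 0 ↔
      M = b := by
  have e : y * ((P * g + Q) * b) - x * (P * g + Q) + (P * y' - Q * y) * b - P * x' + Q * x
      = P * (y * g + y') * (b - M) := by linear_combination P * hm
  rw [e, mul_eq_zero, or_iff_right (mul_ne_zero hP hne), sub_eq_zero, eq_comm]

lemma root_iff (n : ℕ) (hn : 1 ≤ n) (ha : ∀ i, 1 ≤ i → i ≤ n → 0 < (a i).degree)
    {P Q : Polynomial K} {r : ℕ} (hP0 : P ≠ 0) (hP : P.natDegree < r) (hQ : Q.natDegree < r)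
    {β : LaurentSeries K} (hβ : β.order < 0) :
    (aeval (Tinv K) (yCont a n) * β ^ (r + 1) - aeval (Tinv K) (xCont a n) * β ^ r
        + aeval (Tinv K) (P * yCont a (n - 1) - Q * yCont a n) * β
        - aeval (Tinv K) (P * xCont a (n - 1)) + aeval (Tinv K) (Q * xCont a n) = 0) ↔
      Kf a n (hf P Q r β⁻¹) = β⁻¹ := by
  obtain ⟨n, rfl⟩ : ∃ m, n = m + 1 := ⟨n - 1, by omega⟩
  rw [hf_eq hP0 hQ hβ]
  have hγ := gamma_order hP0 hP hQ hβ
  have hP' := ev_ne_zero hP0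
  have hr : β ^ r = ev P * ((β ^ r - ev Q) / ev P) + ev Q := by field_simp; ring
  generalize (β ^ r - ev Q) / ev P = γ at hr hγ
  have hm := mobius a n ha γ hγ
  rw [show n + 1 - 1 = n from rfl, pow_succ, hr]
  simp only [map_sub, map_mul]
  change ev _ * _ - ev _ * _ + (ev _ * ev _ - ev _ * ev _) * _ - ev _ * ev _ + ev _ * ev _ = 0 ↔ _
  have hne : ev (yCont a (n + 1)) * γ + ev (yCont a n) ≠ 0 := by
    intro h
    rw [h, mul_zero] at hm
    have hd := congrArg ev (det_xy a n)
    simp only [ev, map_sub, map_mul, map_pow, map_one] at hd hm h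
    have : aeval (Tinv K) (xCont a (n + 1)) * aeval (Tinv K) (yCont a n)
        - aeval (Tinv K) (xCont a n) * aeval (Tinv K) (yCont a (n + 1)) = 0 := by
      linear_combination aeval (Tinv K) (xCont a (n + 1)) * h
        + aeval (Tinv K) (yCont a (n + 1)) * hm
    rw [this] at hd
    simp at hd
  rw [← inv_inj (a := Kf a (n + 1) γ⁻¹), inv_inv β]
  exact alg_root _ _ _ _ _ _ _ _ _ hP' hne hm

end continuants

/-- Infinite continued fraction data. -/
def CF (b : ℕ → Polynomial K) (αs : ℕ → LaurentSeries K) : Prop :=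
  ∀ n, 1 ≤ n → 0 < (b n).degree ∧ (αs n).order < 0 ∧
      αs n = aeval (Tinv K) (b n) + (αs (n + 1))⁻¹

/-- Rational elements. -/
def Rtl (x : LaurentSeries K) : Prop := ∃ A B : Polynomial K, B ≠ 0 ∧ x * ev B = ev A

lemma Rtl.inv {x : LaurentSeries K} (h : Rtl x) : Rtl x⁻¹ := by
  obtain ⟨A, B, hB, e⟩ := h
  by_cases hx : x = 0
  · subst hx
    exact ⟨0, 1, one_ne_zero, by simp [ev]⟩
  · refine ⟨B, A, ?_, ?_⟩
    · rintro rfl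
      have : x * ev B = 0 := e.trans (map_zero _)
      exact mul_ne_zero hx (ev_ne_zero hB) this
    · rw [← e, inv_mul_cancel_left₀ hx]

lemma Rtl.ev_add {x : LaurentSeries K} (h : Rtl x) (p : Polynomial K) : Rtl (ev p + x) := by
  obtain ⟨A, B, hB, e⟩ := h
  refine ⟨p * B + A, B, hB, ?_⟩
  rw [ev_lin, ← e, add_mul]

lemma Rtl.Kf {x : LaurentSeries K} (h : Rtl x) (a : ℕ → Polynomial K) (n : ℕ) :
    Rtl (Kf a n x) := by
  induction n generalizing x with
  | zero => exact h
  | succ n ih => exact ih (h.ev_add _).inv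

lemma exists_CF (γ : LaurentSeries K) (hγ : γ.order < 0) (hr : ¬ Rtl γ) :
    ∃ b αs, CF b αs ∧ αs 1 = γ := by
  have step : ∀ x : {x : LaurentSeries K // x.order < 0 ∧ ¬ Rtl x},
      ∃ (p : Polynomial K) (y : {x : LaurentSeries K // x.order < 0 ∧ ¬ Rtl x}),
        0 < p.degree ∧ x.1 = ev p + (y.1)⁻¹ := by
    rintro ⟨x, hx, hrx⟩
    obtain ⟨p, hp⟩ := exists_poly_part x
    have hne : x - ev p ≠ 0 := by
      intro h
      rw [sub_eq_zero] at h
      exact hrx ⟨p, 1, one_ne_zero, by rw [h]; simp [ev]⟩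
    refine ⟨p, ⟨(x - ev p)⁻¹, order_inv_neg hp hne, ?_⟩, poly_part_degree hx hp, ?_⟩
    · intro h
      have := h.inv.ev_add p
      rw [inv_inv, add_sub_cancel] at this
      exact hrx this
    · simp
  choose f g hdeg heq using step
  refine ⟨fun n => f (g^[n - 1] ⟨γ, hγ, hr⟩), fun n => (g^[n - 1] ⟨γ, hγ, hr⟩).1, ?_, rfl⟩
  intro n hn
  refine ⟨hdeg _, (g^[n - 1] ⟨γ, hγ, hr⟩).2.1, ?_⟩
  obtain ⟨m, rfl⟩ : ∃ m, n = m + 1 := ⟨n - 1, by omega⟩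
  simp only [Nat.add_sub_cancel, Function.iterate_succ_apply']
  exact heq _

lemma CF_prepend {b : ℕ → Polynomial K} {αs : ℕ → LaurentSeries K} (h : CF b αs)
    {p : Polynomial K} (hp : 0 < p.degree) :
    CF (fun n => if n ≤ 1 then p else b (n - 1))
      (fun n => if n ≤ 1 then ev p + (αs 1)⁻¹ else αs (n - 1)) := by
  intro n hn
  obtain rfl | hn' : n = 1 ∨ 2 ≤ n := by omega
  · simp only [le_refl, if_true]
    exact ⟨hp, order_ev_add hp (G_inv (h 1 le_rfl).2.1), by simp⟩
  · have := h (n - 1) (by omega)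
    simp only [show ¬ n ≤ 1 by omega, show ¬ n + 1 ≤ 1 by omega, if_false]
    rwa [show n - 1 + 1 = n + 1 - 1 by omega] at this

lemma CF_extend (a : ℕ → Polynomial K) (n : ℕ) (ha : ∀ i, 1 ≤ i → i ≤ n → 0 < (a i).degree)
    (b0 : ℕ → Polynomial K) (α0 : ℕ → LaurentSeries K) (h : CF b0 α0) :
    ∃ b αs, CF b αs ∧ αs 1 = (Kf a n (α0 1)⁻¹)⁻¹ ∧ (∀ i, 1 ≤ i → i ≤ n → b i = a i) ∧
      ∀ k, 1 ≤ k → αs (n + k) = α0 k ∧ b (n + k) = b0 k := by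
  induction n generalizing b0 α0 with
  | zero =>
    exact ⟨b0, α0, h, by simp [Kf], fun i h1 h2 => by omega, fun k _ => by simp⟩
  | succ n ih =>
    obtain ⟨b, αs, h1, h2, h3, h4⟩ := ih (fun i h1 h2 => ha i h1 (by omega)) _ _
      (CF_prepend h (ha (n + 1) (by omega) le_rfl))
    refine ⟨b, αs, h1, ?_, ?_, ?_⟩
    · rw [h2, Kf]
      simp
    · intro i hi1 hi2
      obtain hi | rfl : i ≤ n ∨ i = n + 1 := by omega
      · exact h3 i hi1 hi
      · rw [(h4 1 le_rfl).2]
        simp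
    · intro k hk
      have := h4 (1 + k) (by omega)
      rw [← add_assoc] at this
      rw [this.1, this.2]
      simp [show k ≠ 0 by omega]

lemma Kf_of_CF (a b : ℕ → Polynomial K) (αs : ℕ → LaurentSeries K) (h : CF b αs) (n : ℕ)
    (hb : ∀ i, 1 ≤ i → i ≤ n → b i = a i) : Kf a n (αs (n + 1))⁻¹ = (αs 1)⁻¹ := by
  induction n with
  | zero => rfl
  | succ n ih =>
    rw [← ih (fun i h1 h2 => hb i h1 (by omega)), (h (n + 1) (by omega)).2.2, hb (n + 1) (by omega)
      le_rfl, Kf]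

lemma alg_cancel {F : Type*} [Field F] (c g D : F) : (c + g) * D - c * D = g * D := by ring

lemma ev_sub_mul (C c D : Polynomial K) : ev (C - c * D) = ev C - ev c * ev D := by
  simp only [ev, map_sub, map_mul]

lemma denom_step {c : Polynomial K} {γ : LaurentSeries K} (hγ : γ.order < 0)
    {C D : Polynomial K} (hD : D ≠ 0) (h1 : (ev c + γ⁻¹) * ev D = ev C) :
    C - c * D ≠ 0 ∧ γ * ev (C - c * D) = ev D ∧ (C - c * D).natDegree + 1 ≤ D.natDegree := by
  have h0 := ne_zero_of_order hγ
  have hE : ev (C - c * D) = γ⁻¹ * ev D := by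
    rw [ev_sub_mul, ← h1]
    exact alg_cancel _ _ _
  have hG := (G_inv hγ).mul (G_ev D)
  rw [← hE] at hG
  have hE0 : C - c * D ≠ 0 := by
    intro h
    have h2 : ev (C - c * D) ≠ 0 := by
      rw [hE]
      exact mul_ne_zero (inv_ne_zero h0) (ev_ne_zero hD)
    rw [h] at h2
    exact h2 (map_zero _)
  refine ⟨hE0, ?_, ?_⟩
  · rw [hE, mul_inv_cancel_left₀ h0]
  · generalize C - c * D = E at hG hE0
    by_contra hlt
    have := hG (-(E.natDegree : ℤ)) (by omega)
    rw [ev_coeff, coeff_natDegree, leadingCoeff_eq_zero] at this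
    exact hE0 this

lemma denom_descent (a : ℕ → Polynomial K) (n : ℕ)
    (ha : ∀ i, 1 ≤ i → i ≤ n → 0 < (a i).degree) (γ : LaurentSeries K) (hγ : γ.order < 0)
    (A B : Polynomial K) (hB : B ≠ 0) (e : (Kf a n γ⁻¹)⁻¹ * ev B = ev A) :
    ∃ C D : Polynomial K, D ≠ 0 ∧ γ * ev D = ev C ∧ D.natDegree + n ≤ B.natDegree := by
  induction n generalizing γ with
  | zero =>
    rw [Kf, inv_inv] at e
    exact ⟨A, B, hB, e, le_rfl⟩
  | succ n ih =>
    have hδ := order_ev_add (ha (n + 1) (by omega) le_rfl) (G_inv hγ)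
    rw [Kf] at e
    obtain ⟨C, D, hD, h1, h2⟩ := ih (fun i h1 h2 => ha i h1 (by omega)) _ hδ e
    obtain ⟨h3, h4, h5⟩ := denom_step hγ hD h1
    exact ⟨D, _, h3, h4, by omega⟩

lemma Rtl.coprime {x : LaurentSeries K} (h : Rtl x) :
    ∃ A B : Polynomial K, B ≠ 0 ∧ IsCoprime A B ∧ x * ev B = ev A := by
  obtain ⟨A, B, hB, e⟩ := h
  classical
  have hg : EuclideanDomain.gcd A B ≠ 0 := fun h => hB (EuclideanDomain.gcd_eq_zero_iff.1 h).2
  obtain ⟨A', hA'⟩ := EuclideanDomain.gcd_dvd_left A B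
  obtain ⟨B', hB'⟩ := EuclideanDomain.gcd_dvd_right A B
  have hbez := EuclideanDomain.gcd_eq_gcd_ab A B
  generalize EuclideanDomain.gcdA A B = u at hbez
  generalize EuclideanDomain.gcdB A B = v at hbez
  generalize EuclideanDomain.gcd A B = d at *
  subst hA' hB'
  refine ⟨A', B', right_ne_zero_of_mul hB, ⟨u, v, ?_⟩, ?_⟩
  · apply mul_left_cancel₀ hg
    linear_combination -hbez
  · apply mul_left_cancel₀ (ev_ne_zero hg)
    have e' : x * (ev d * ev B') = ev d * ev A' := by
      simpa only [ev, map_mul] using e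
    rw [← e']
    ring

lemma irrational (a : ℕ → Polynomial K) (n : ℕ) (hn : 1 ≤ n)
    (ha : ∀ i, 1 ≤ i → i ≤ n → 0 < (a i).degree) (P Q : Polynomial K) (r : ℕ) (hr : 1 ≤ r)
    (γ : LaurentSeries K) (hγ : γ.order < 0)
    (e : ((Kf a n γ⁻¹)⁻¹) ^ r = ev P * γ + ev Q) : ¬ Rtl γ := by
  intro h
  obtain ⟨A, B, hB, hco, hAB⟩ := (h.inv.Kf a n).inv.coprime
  obtain ⟨C, D, hD, h1, h2⟩ := denom_descent a n ha γ hγ A B hB hAB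
  have key : A ^ r * D = B ^ r * (P * C + Q * D) := by
    apply ev_injective
    have l : ev (A ^ r * D) = ev A ^ r * ev D := by simp only [ev, map_mul, map_pow]
    have l' : ev (B ^ r * (P * C + Q * D)) = ev B ^ r * (ev P * ev C + ev Q * ev D) := by
      simp only [ev, map_mul, map_pow, map_add]
    rw [l, l', ← hAB, mul_pow, e, ← h1]
    ring
  have hdvd : B ^ r ∣ D :=
    (hco.symm.pow (m := r) (n := r)).dvd_of_dvd_mul_left (Dvd.intro _ key.symm)
  have := natDegree_le_of_dvd hdvd hD
  rw [natDegree_pow] at this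
  have : B.natDegree ≤ r * B.natDegree := Nat.le_mul_of_pos_left _ hr
  omega

lemma isCFSol_iff (a : ℕ → Polynomial K) (n : ℕ) (hn : 1 ≤ n)
    (ha : ∀ i, 1 ≤ i → i ≤ n → 0 < (a i).degree)
    {P Q : Polynomial K} {r : ℕ} (hP0 : P ≠ 0) (hP : P.natDegree < r) (hQ : Q.natDegree < r)
    {β : LaurentSeries K} (hβ : β.order < 0) :
    IsCFSol K r n a P Q β ↔ Kf a n (hf P Q r β⁻¹) = β⁻¹ := by
  rw [hf_eq hP0 hQ hβ]
  have hP' := ev_ne_zero hP0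
  constructor
  · rintro ⟨-, b, αs, h1, hb, hcf, hr⟩
    have : (β ^ r - ev Q) / ev P = αs (n + 1) := by
      rw [hr, add_sub_cancel_right, mul_div_cancel_left₀ _ hP']
    rw [this, Kf_of_CF a b αs hcf n hb, h1]
  · intro h
    have hγ := gamma_order hP0 hP hQ hβ
    have hr : β ^ r = ev P * ((β ^ r - ev Q) / ev P) + ev Q := by
      rw [mul_div_cancel₀ _ hP', sub_add_cancel]
    generalize (β ^ r - ev Q) / ev P = γ at hr hγ h
    have hirr := irrational a n hn ha P Q r (by omega) γ hγ (by rw [h, inv_inv, hr])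
    obtain ⟨b0, α0, hcf0, h0⟩ := exists_CF γ hγ hirr
    obtain ⟨b, αs, hcf, h1, hb, h2⟩ := CF_extend a n ha b0 α0 hcf0
    refine ⟨hβ, b, αs, ?_, hb, hcf, ?_⟩
    · rw [h1, h0, h, inv_inv]
    · rw [(h2 1 le_rfl).1, h0]
      exact hr

end CFAux

theorem stmt_0 (p s t q r : ℕ) (hp : Nat.Prime p) (hs : 1 ≤ s) (ht : 1 ≤ t)
    (hq : q = p ^ s) (hr : r = p ^ t)
    (Fq : Type*) [Field Fq] [Fintype Fq] (hcard : Fintype.card Fq = q)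
    (ℓ : ℕ) (hℓ : 1 ≤ ℓ)
    (a : ℕ → Polynomial Fq) (ha : ∀ i, 1 ≤ i → i ≤ ℓ → 0 < (a i).degree)
    (P Q : Polynomial Fq) (hQP : Q.degree < P.degree) (hPr : P.degree < (r : WithBot ℕ)) :
    ∃ α : LaurentSeries Fq,
      IsCFSol Fq r ℓ a P Q α ∧
      (∀ β : LaurentSeries Fq, IsCFSol Fq r ℓ a P Q β → β = α) ∧
      (aeval (Tinv Fq) (yCont a ℓ) * α ^ (r + 1) - aeval (Tinv Fq) (xCont a ℓ) * α ^ r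
        + aeval (Tinv Fq) (P * yCont a (ℓ - 1) - Q * yCont a ℓ) * α
        - aeval (Tinv Fq) (P * xCont a (ℓ - 1)) + aeval (Tinv Fq) (Q * xCont a ℓ) = 0) ∧
      (∀ β : LaurentSeries Fq, β.order < 0 →
        aeval (Tinv Fq) (yCont a ℓ) * β ^ (r + 1) - aeval (Tinv Fq) (xCont a ℓ) * β ^ r
          + aeval (Tinv Fq) (P * yCont a (ℓ - 1) - Q * yCont a ℓ) * β
          - aeval (Tinv Fq) (P * xCont a (ℓ - 1)) + aeval (Tinv Fq) (Q * xCont a ℓ) = 0 →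
        β = α) := by
  have hP0 : P ≠ 0 := by
    rintro rfl
    simp at hQP
  have hP : P.natDegree < r := (natDegree_lt_iff_degree_lt hP0).2 hPr
  have hQ : Q.natDegree < r := lt_of_le_of_lt (natDegree_le_natDegree hQP.le) hP
  obtain ⟨⟨z, hz, hzf⟩, huniq⟩ := CFAux.fixed a ℓ hℓ ha hP hQ
  have hz0 : z ≠ 0 := by
    rw [← hzf]
    exact CFAux.Kf_ne_zero a ℓ ha _ (CFAux.hf_G hP hQ hz) (Or.inr hℓ)
  have hα := CFAux.order_inv_neg hz hz0
  have hfix : CFAux.Kf a ℓ (CFAux.hf P Q r (z⁻¹)⁻¹) = (z⁻¹)⁻¹ := by rw [inv_inv, hzf]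
  have hun : ∀ β : LaurentSeries Fq, β.order < 0 →
      CFAux.Kf a ℓ (CFAux.hf P Q r β⁻¹) = β⁻¹ → β = z⁻¹ := by
    intro β hβ h
    rw [← huniq _ _ (CFAux.G_inv hβ) hz h hzf, inv_inv]
  refine ⟨z⁻¹, (CFAux.isCFSol_iff a ℓ hℓ ha hP0 hP hQ hα).2 hfix, ?_,
    (CFAux.root_iff a ℓ hℓ ha hP0 hP hQ hα).2 hfix, ?_⟩
  · intro β h
    exact hun β h.1 ((CFAux.isCFSol_iff a ℓ hℓ ha hP0 hP hQ h.1).1 h)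
  · intro β hβ h
    exact hun β hβ ((CFAux.root_iff a ℓ hℓ ha hP0 hP hQ hβ).1 h)
end
end

section
/- We have R_k = 2k·ω_k·Q_k in F_p[T], where Q_k(T) = Σ_{0≤i≤k−1} (−1)^{k−1−i}·C(k−1, i)·(2i+1)^{−1}·T^{2i+1} (the binomial coefficients C(k−1,i) and the inverses (2i+1)^{−1} being taken in F_p, which is possible since 2i+1 ≤ 2k−1 < p). -/
open Polynomial

noncomputable section

/-- `P_k(T) = (T² - 1)^k` in `F_p[T]`. -/
def Pk (p k : ℕ) : Polynomial (ZMod p) := ((X : Polynomial (ZMod p)) ^ 2 - 1) ^ k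

/-- `R_k`, the remainder in the Euclidean division of `T^p` by `P_k`. -/
def Rk (p k : ℕ) : Polynomial (ZMod p) := (X : Polynomial (ZMod p)) ^ p %ₘ Pk p k

theorem aux_dvd (p : ℕ) [Fact (Nat.Prime p)] (a : ZMod p) (f : Polynomial (ZMod p))
    (hf : f.eval a = 0) (n : ℕ) (hn : n < p) (h : (X - C a) ^ n ∣ derivative f) :
    (X - C a) ^ (n + 1) ∣ f := by
  induction n with
  | zero => simpa using dvd_iff_isRoot.2 hf
  | succ n ih =>
    obtain ⟨g, rfl⟩ := ih (by omega) ((pow_dvd_pow _ (Nat.le_succ n)).trans h)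
    rw [pow_succ]
    apply mul_dvd_mul_left
    have h1 : derivative ((X - C a) ^ (n + 1) * g)
        = (X - C a) ^ n * (C ((n + 1 : ℕ) : ZMod p) * g + (X - C a) * derivative g) := by
      simp [derivative_mul, derivative_pow]
      ring
    rw [h1, pow_succ] at h
    have h2 := (mul_dvd_mul_iff_left (pow_ne_zero n (X_sub_C_ne_zero a))).1 h
    have h3 := (dvd_add_left (Dvd.intro _ rfl)).1 h2
    rw [dvd_iff_isRoot, IsRoot.def, eval_mul, eval_C] at h3
    rw [dvd_iff_isRoot, IsRoot.def]
    refine (mul_eq_zero.1 h3).resolve_left ?_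
    refine fun hz => absurd ((ZMod.natCast_eq_zero_iff _ _).1 hz) ?_
    exact Nat.not_dvd_of_pos_of_lt (by omega) hn

theorem aux_diff {K : Type*} [Field K] (n : ℕ) (x : K)
    (h : ∀ i ≤ n, x + 2 * (i : K) ≠ 0) :
    (fwdDiff (2 : K))^[n] (fun y => y⁻¹) x
      = (-1) ^ n * 2 ^ n * (n.factorial : K) * (∏ i ∈ Finset.range (n + 1), (x + 2 * (i : K)))⁻¹ := by
  induction n generalizing x with
  | zero => simp
  | succ n ih =>
    rw [Function.iterate_succ_apply', fwdDiff, ih x (fun i hi => h i (by omega)),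
      ih (x + 2) (fun i hi => by
        have := h (i + 1) (by omega)
        push_cast at this
        convert this using 1; ring)]
    have hs : ∀ i : ℕ, x + 2 + 2 * (i : K) = x + 2 * ((i + 1 : ℕ) : K) := by
      intro i; push_cast; ring
    simp only [hs]
    rw [Finset.prod_range_succ (fun i : ℕ => x + 2 * ((i + 1 : ℕ) : K)),
      Finset.prod_range_succ' (fun i : ℕ => x + 2 * (i : K)) n,
      Finset.prod_range_succ' (fun i : ℕ => x + 2 * (i : K)) (n + 1),
      Finset.prod_range_succ (fun i : ℕ => x + 2 * ((i + 1 : ℕ) : K))]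
    have hP : ∏ i ∈ Finset.range n, (x + 2 * ((i + 1 : ℕ) : K)) ≠ 0 :=
      Finset.prod_ne_zero_iff.2 fun i hi => h _ (by simp at hi; omega)
    have h0 := h 0 (by omega)
    have hl := h (n + 1) le_rfl
    rw [Nat.factorial_succ]
    generalize ∏ i ∈ Finset.range n, (x + 2 * ((i + 1 : ℕ) : K)) = P at *
    push_cast at *
    simp only [mul_zero, add_zero] at *
    field_simp
    ring

theorem aux_prod {K : Type*} [Field K] (n : ℕ) (h2 : (2 : K) ≠ 0)
    (h : ∀ i, 1 ≤ i → i ≤ n + 1 → (i : K) ≠ 0)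
    (h' : ∀ i ≤ n, (1 : K) + 2 * (i : K) ≠ 0) :
    2 * ((n + 1 : ℕ) : K) * (∏ i ∈ Finset.Icc 1 (n + 1), (1 - (2 * (i : K))⁻¹)) *
      (2 ^ n * (n.factorial : K) * (∏ i ∈ Finset.range (n + 1), (1 + 2 * (i : K)))⁻¹) = 1 := by
  induction n with
  | zero => simp; field_simp; norm_num
  | succ n ih =>
    have ih := ih (fun i a b => h i a (by omega)) (fun i a => h' i (by omega))
    rw [Finset.prod_Icc_succ_top (by omega), Finset.prod_range_succ _ (n + 1), Nat.factorial_succ]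
    have a1 := h (n + 1) (by omega) (by omega)
    have a2 := h (n + 1 + 1) (by omega) (by omega)
    have a3 := h' (n + 1) (by omega)
    have hP : ∏ i ∈ Finset.range (n + 1), ((1 : K) + 2 * (i : K)) ≠ 0 :=
      Finset.prod_ne_zero_iff.2 fun i hi => h' _ (by simp at hi; omega)
    generalize ∏ i ∈ Finset.range (n + 1), ((1 : K) + 2 * (i : K)) = P at *
    generalize ∏ i ∈ Finset.Icc 1 (n + 1), (1 - (2 * (i : K))⁻¹) = W at *
    push_cast at *
    refine Eq.trans ?_ ih
    field_simp
    ring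

theorem stmt_2 (p k : ℕ) [Fact (Nat.Prime p)] (hodd : Odd p)
    (hk1 : 1 ≤ k) (hk2 : 2 * k < p)
    (ω : ZMod p)
    (hω : ω = (-1) ^ (k - 1) * ∏ i ∈ Finset.Icc 1 k, (1 - (2 * (i : ZMod p))⁻¹)) :
    Rk p k = C (2 * (k : ZMod p) * ω) *
      ∑ i ∈ Finset.range k,
        C ((-1) ^ (k - 1 - i) * ((k - 1).choose i : ZMod p) * (((2 * i + 1 : ℕ) : ZMod p))⁻¹)
          * X ^ (2 * i + 1) := by
  obtain ⟨n, rfl⟩ : ∃ n, k = n + 1 := ⟨k - 1, by omega⟩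
  simp only [Nat.add_sub_cancel] at *
  have hne : ∀ i : ℕ, 1 ≤ i → i < p → (i : ZMod p) ≠ 0 := by
    intro i h1 h2
    refine fun hz => absurd ((ZMod.natCast_eq_zero_iff _ _).1 hz) ?_
    exact Nat.not_dvd_of_pos_of_lt (by omega) h2
  have h2 : (2 : ZMod p) ≠ 0 := by exact_mod_cast hne 2 (by omega) (by omega)
  have hodd' : ∀ i ≤ n, (1 : ZMod p) + 2 * (i : ZMod p) ≠ 0 := by
    intro i hi
    have := hne (1 + 2 * i) (by omega) (by omega)
    exact_mod_cast this
  set Q : Polynomial (ZMod p) := ∑ i ∈ Finset.range (n + 1),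
        C ((-1) ^ (n - i) * (n.choose i : ZMod p) * (((2 * i + 1 : ℕ) : ZMod p))⁻¹)
          * X ^ (2 * i + 1) with hQ
  set c := 2 * ((n + 1 : ℕ) : ZMod p) * ω with hc
  have hQ1 : Q.eval 1 = (-1) ^ n * (2 ^ n * (n.factorial : ZMod p) *
      (∏ i ∈ Finset.range (n + 1), (1 + 2 * (i : ZMod p)))⁻¹) := by
    have := aux_diff n (1 : ZMod p) hodd'
    rw [fwdDiff_iter_eq_sum_shift] at this
    rw [← mul_assoc, ← mul_assoc, ← this, hQ, eval_finsetSum]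
    refine Finset.sum_congr rfl fun i _ => ?_
    simp [zsmul_eq_mul]
    left
    ring
  have hcQ : c * Q.eval 1 = 1 := by
    rw [hc, hQ1, hω]
    refine Eq.trans ?_ (aux_prod n h2 (fun i a b => hne i a (by omega)) hodd')
    have : ((-1 : ZMod p) ^ n) * (-1) ^ n = 1 := by rw [← mul_pow]; simp
    linear_combination (2 * ((n + 1 : ℕ) : ZMod p) *
      (∏ i ∈ Finset.Icc 1 (n + 1), (1 - (2 * (i : ZMod p))⁻¹)) *
      (2 ^ n * (n.factorial : ZMod p) *
      (∏ i ∈ Finset.range (n + 1), (1 + 2 * (i : ZMod p)))⁻¹)) * this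
  have hQm : Q.eval (-1) = - Q.eval 1 := by
    rw [hQ, eval_finsetSum, eval_finsetSum, ← Finset.sum_neg_distrib]
    refine Finset.sum_congr rfl fun i _ => ?_
    simp [pow_succ, pow_mul]
  have hQd : derivative Q = (X ^ 2 - 1) ^ n := by
    rw [hQ, derivative_sum, sub_eq_add_neg, add_pow]
    refine Finset.sum_congr rfl fun i hi => ?_
    have := hne (2 * i + 1) (by omega) (by simp at hi; omega)
    rw [derivative_C_mul_X_pow, mul_assoc, inv_mul_cancel₀ this]
    simp [pow_mul]
    ring
  have hdeg : (C c * Q).degree < (Pk p (n + 1)).degree := by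
    have e1 : (Pk p (n + 1)).degree = ((2 * (n + 1) : ℕ) : WithBot ℕ) := by
      have : (X ^ 2 - 1 : Polynomial (ZMod p)).degree = 2 := by
        simpa using degree_X_pow_sub_C (n := 2) (by norm_num) (1 : ZMod p)
      rw [Pk, degree_pow, this]
      push_cast
      simp
      ring
    rw [e1, C_mul', ← mem_degreeLT]
    refine Submodule.smul_mem _ _ (Submodule.sum_mem _ fun i hi => ?_)
    rw [mem_degreeLT]
    refine (degree_C_mul_X_pow_le _ _).trans_lt ?_
    simp at hi
    exact_mod_cast (by omega : 2 * i + 1 < 2 * (n + 1))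
  have hmon : (Pk p (n + 1)).Monic := by
    have := monic_X_pow_sub_C (n := 2) (1 : ZMod p) (by norm_num)
    rw [C_1] at this
    exact this.pow _
  have hfac : (X ^ 2 - 1 : Polynomial (ZMod p)) = (X - C 1) * (X - C (-1)) := by
    simp; ring
  have hder : derivative (X ^ p - C c * Q) = - C c * (X ^ 2 - 1) ^ n := by
    simp [hQd, derivative_X_pow]
  have d1 : (X - C 1) ^ (n + 1) ∣ X ^ p - C c * Q := by
    refine aux_dvd p _ _ ?_ n (by omega) ?_
    · simp [hcQ]
    · rw [hder, hfac, mul_pow]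
      exact (Dvd.intro _ rfl).mul_left _
  have d2 : (X - C (-1)) ^ (n + 1) ∣ X ^ p - C c * Q := by
    refine aux_dvd p _ _ ?_ n (by omega) ?_
    · simp [hQm, hcQ, hodd.neg_one_pow]
    · rw [hder, hfac, mul_pow]
      exact (Dvd.intro_left _ rfl).mul_left _
  have hcop : IsCoprime ((X - C 1) ^ (n + 1)) ((X - C (-1) : Polynomial (ZMod p)) ^ (n + 1)) := by
    refine (isCoprime_X_sub_C_of_isUnit_sub ?_).pow
    rw [isUnit_iff_ne_zero]
    intro h
    apply h2
    linear_combination h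
  obtain ⟨q, hq⟩ := hcop.mul_dvd d1 d2
  rw [← mul_pow, ← hfac] at hq
  refine (div_modByMonic_unique q (C c * Q) hmon ⟨?_, hdeg⟩).2
  rw [Pk, ← hq]
  ring
end
end

section
/- In F_p(T) we have the finite continued fraction expansion T^p/P_k = [A_1, w_1T, w_2T, ..., w_{2k}T], and equivalently P_k/R_k = [w_1T, w_2T, ..., w_{2k}T]. -/
open Polynomial

noncomputable section

/-- Finite continued fraction `[a₁,…,aₙ] = a₁ + 1/(a₂ + 1/(…))`. -/
def cfrac {K : Type*} [DivisionRing K] : List K → K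
  | [] => 0
  | [a] => a
  | a :: b :: l => a + (cfrac (b :: l))⁻¹

/-- `A_1 = [T^p / P_k]`, the quotient in the Euclidean division of `T^p` by `P_k`. -/
def A1 (p k : ℕ) : Polynomial (ZMod p) := (X : Polynomial (ZMod p)) ^ p /ₘ Pk p k

/-- recurrence coefficient -/
def bt (p k n : ℕ) : ZMod p :=
  (n : ZMod p) * (2 * k - n) * ((2 * (n : ZMod p) - 2 * k - 1) * (2 * (n : ZMod p) - 2 * k + 1))⁻¹

/-- monic Gegenbauer-type polynomials -/
def ff (p k : ℕ) : ℕ → Polynomial (ZMod p)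
  | 0 => 1
  | 1 => X
  | (n + 2) => X * ff p k (n + 1) + C (bt p k (n + 1)) * ff p k n

lemma int_ne (p : ℕ) (z : ℤ) (h0 : z ≠ 0) (h1 : |z| < p) : (z : ZMod p) ≠ 0 := by
  intro h
  rw [ZMod.intCast_zmod_eq_zero_iff_dvd] at h
  exact h0 (Int.eq_zero_of_abs_lt_dvd h h1)

lemma den1 (p k n : ℕ) (hk2 : 2 * k < p) (h1 : 1 ≤ n) (h2 : n ≤ 2 * k) :
    (2 * (n : ZMod p) - 2 * k - 1) ≠ 0 := by
  have := int_ne p (2 * n - 2 * k - 1) (by omega) (by rw [abs_lt]; omega)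
  push_cast at this
  exact this

lemma den2 (p k n : ℕ) (hk2 : 2 * k < p) (h2 : n + 1 ≤ 2 * k) :
    (2 * (n : ZMod p) - 2 * k + 1) ≠ 0 := by
  have := int_ne p (2 * n - 2 * k + 1) (by omega) (by rw [abs_lt]; omega)
  push_cast at this
  exact this

lemma nat_ne (p n : ℕ) (h2 : n < p) (h1 : 1 ≤ n) : (n : ZMod p) ≠ 0 := by
  have := int_ne p n (by omega) (by rw [abs_lt]; omega)
  push_cast at this
  exact this

lemma ff_monic (p k : ℕ) [Fact (Nat.Prime p)] (n : ℕ) :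
    ((ff p k n).Monic ∧ (ff p k n).natDegree = n) ∧
    ((ff p k (n+1)).Monic ∧ (ff p k (n+1)).natDegree = n + 1) := by
  induction n with
  | zero => simp [ff, monic_X]
  | succ n ih =>
    refine ⟨ih.2, ?_⟩
    obtain ⟨⟨h1, h2⟩, h3, h4⟩ := ih
    have hm : (X * ff p k (n + 1)).Monic := monic_X.mul h3
    have hd : (X * ff p k (n + 1)).natDegree = n + 2 := by
      rw [monic_X.natDegree_mul h3, h4, natDegree_X]; ring
    have hlt : (C (bt p k (n + 1)) * ff p k n).natDegree < (X * ff p k (n + 1)).natDegree := by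
      rw [hd]
      exact lt_of_le_of_lt (natDegree_C_mul_le _ _) (by omega)
    have hlt' := degree_lt_degree hlt
    refine ⟨?_, ?_⟩
    · exact hm.add_of_left hlt'
    · show (X * ff p k (n + 1) + C (bt p k (n + 1)) * ff p k n).natDegree = _
      rw [natDegree_add_eq_left_of_natDegree_lt hlt, hd]

lemma ff_eval (p k : ℕ) [Fact (Nat.Prime p)] (n : ℕ) : (ff p k (2 * n + 1)).eval 0 = 0 := by
  induction n with
  | zero => simp [ff]
  | succ n ih =>
    show (X * ff p k (2 * n + 1 + 1) + C (bt p k (2 * n + 1 + 1)) * ff p k (2 * n + 1)).eval 0 = 0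
    simp [ih]

lemma aux1 {F : Type*} [Field F] (x a b : F) (hb : b ≠ 0) :
    x * a⁻¹ = b * (x * (a * b)⁻¹) := by
  rw [mul_inv]; field_simp

lemma aux2 {F : Type*} [Field F] (x y a b : F) (ha : a ≠ 0) (hb : b ≠ 0) (h : x = y - b) :
    x * b⁻¹ = a * (y * (a * b)⁻¹) - 1 := by
  subst h; field_simp

lemma aux3 {F : Type*} [Field F] (x y a b : F) (hx : x ≠ 0) (hy : y ≠ 0)
    (ha : a ≠ 0) (hb : b ≠ 0) :
    a * b * (y * x)⁻¹ * (x * y * (a * b)⁻¹) = 1 := by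
  field_simp

lemma ladder (p k : ℕ) [Fact (Nat.Prime p)] (hk2 : 2 * k < p) (n : ℕ) (hn : n + 1 ≤ 2 * k) :
    (X ^ 2 - 1) * derivative (ff p k (n + 1)) = C ((n : ZMod p) + 1) * X * ff p k (n + 1) +
      C (((n : ZMod p) + 1) * (2 * k - (n + 1)) * (2 * ((n : ZMod p) + 1) - 2 * k - 1)⁻¹) * ff p k n ∧
    (X ^ 2 - 1) * derivative (ff p k n) = C (2 * (n : ZMod p) - 2 * k + 1) * ff p k (n + 1) +
      C (2 * (k : ZMod p) - n - 1) * X * ff p k n := by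
  induction n with
  | zero =>
    have h := den2 p k 0 hk2 hn
    have h' : (2 * (1 : ZMod p) - 2 * k - 1) ≠ 0 := by
      convert h using 1; push_cast; ring
    have h2 : (2 * (k : ZMod p) - 1) * (2 * 1 - 2 * (k : ZMod p) - 1)⁻¹ = -1 := by
      rw [← div_eq_mul_inv, div_eq_iff h']; ring
    simp only [ff, Nat.cast_zero, zero_add, derivative_X, derivative_one, one_mul, h2]
    refine ⟨by simp; ring, ?_⟩
    simp only [map_sub, map_add, map_mul, map_one, map_zero]
    ring_nf
  | succ n ih =>
    obtain ⟨hS, hU⟩ := ih (by omega)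
    have hd1 := den1 p k (n+1) hk2 (by omega) (by omega)
    have hd2 := den2 p k (n+1) hk2 (by omega)
    have hd3 := den1 p k (n+2) hk2 (by omega) (by omega)
    push_cast at hd1 hd2 hd3
    have hf : ff p k (n + 1 + 1) = X * ff p k (n + 1) + C (bt p k (n + 1)) * ff p k n := rfl
    have hg : (n + 1 : ZMod p) * (2 * k - (n + 1)) * (2 * ((n : ZMod p) + 1) - 2 * k - 1)⁻¹
        = (2 * ((n : ZMod p) + 1) - 2 * k + 1) * bt p k (n + 1) := by
      unfold bt; push_cast; exact aux1 _ _ _ hd2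
    have hg2 : ((n + 1 : ZMod p) + 1) * (2 * k - ((n + 1) + 1)) *
        (2 * ((n + 1 : ZMod p) + 1) - 2 * k - 1)⁻¹
        = (2 * ((n : ZMod p) + 1) - 2 * k - 1) * bt p k (n + 1) - 1 := by
      have hd3' : (2 * ((n + 1 : ZMod p) + 1) - 2 * k - 1) ≠ 0 := by
        convert hd2 using 1; ring
      have he : (2 * ((n + 1 : ZMod p) + 1) - 2 * k - 1) = 2 * ((n : ZMod p) + 1) - 2 * k + 1 := by
        ring
      unfold bt; push_cast
      rw [he]
      exact aux2 _ _ _ _ hd1 hd2 (by ring)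
    push_cast
    rw [hg2]
    rw [hg] at hS
    rw [hf]
    generalize bt p k (n + 1) = b at *
    generalize ff p k (n + 1) = F at *
    generalize ff p k n = G at *
    simp only [derivative_add, derivative_mul, derivative_X, derivative_C] at *
    simp only [map_sub, map_add, map_mul, map_one, map_natCast, map_ofNat] at *
    constructor
    · linear_combination X * hS + C b * hU
    · linear_combination hS

lemma ff_top (p k : ℕ) [Fact (Nat.Prime p)] (hk1 : 1 ≤ k) (hk2 : 2 * k < p) :
    ff p k (2 * k) = Pk p k := by
  obtain ⟨n, rfl⟩ : ∃ n, k = n + 1 := ⟨k - 1, by omega⟩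
  set k := n + 1 with hk
  have hS := (ladder p k hk2 (2 * n + 1) (by omega)).1
  have e : 2 * n + 1 + 1 = 2 * k := by omega
  have e2 : ((2 * n + 1 : ℕ) : ZMod p) + 1 = 2 * k := by
    rw [hk]; push_cast; ring
  rw [e, e2] at hS
  simp only [sub_self, mul_zero, zero_mul, map_zero, add_zero] at hS
  have hm : (X ^ 2 - 1 : (ZMod p)[X]).Monic := by
    simpa using monic_X_pow_sub_C (1 : ZMod p) (n := 2) (by norm_num)
  have hdg : (X ^ 2 - 1 : (ZMod p)[X]).natDegree = 2 := by
    simpa using natDegree_X_pow_sub_C (r := (1 : ZMod p)) (n := 2)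
  have hPm : (Pk p k).Monic := hm.pow k
  have hPd : (Pk p k).natDegree = 2 * k := by
    unfold Pk; rw [hm.natDegree_pow, hdg]; ring
  have hP : (X ^ 2 - 1) * derivative (Pk p k) = C (2 * (k : ZMod p)) * X * Pk p k := by
    unfold Pk
    rw [derivative_pow, hk]
    simp [C_ofNat]
    ring
  obtain ⟨fm, fd⟩ := (ff_monic p k (2 * k)).1
  by_contra hne
  set D := ff p k (2 * k) - Pk p k with hD
  have hD0 : D ≠ 0 := sub_ne_zero.mpr hne
  have hDe : X * (X * derivative D) - derivative D = C (2 * (k : ZMod p)) * (X * D) := by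
    rw [hD, derivative_sub]; linear_combination hS - hP
  have hlt : D.natDegree < 2 * k := by
    have := degree_sub_lt_left (p := ff p k (2*k)) (q := Pk p k)
      (by rw [degree_eq_natDegree fm.ne_zero, degree_eq_natDegree hPm.ne_zero, fd, hPd])
      fm.ne_zero (by rw [fm.leadingCoeff, hPm.leadingCoeff])
    have := natDegree_lt_natDegree hD0 this
    omega
  have hc := congrArg (fun q => coeff q (D.natDegree + 1)) hDe
  simp only [coeff_sub, coeff_X_mul, coeff_C_mul, coeff_derivative] at hc
  rw [coeff_eq_zero_of_natDegree_lt (show D.natDegree < D.natDegree + 1 + 1 by omega)] at hc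
  have hx : (X * derivative D).coeff D.natDegree = D.natDegree * D.coeff D.natDegree := by
    rcases D.natDegree with _ | e
    · simp
    · rw [coeff_X_mul, coeff_derivative]; push_cast; ring
  rw [hx, coeff_natDegree] at hc
  have hz := int_ne p (2 * k - D.natDegree) (by omega) (by rw [abs_lt]; omega)
  push_cast at hz
  have := mul_ne_zero hz (leadingCoeff_ne_zero.mpr hD0)
  apply this
  linear_combination -hc

lemma Rk_eq (p k : ℕ) [Fact (Nat.Prime p)] (hodd : Odd p) (hk2 : 2 * k < p) :
    Rk p (k) = X * ∑ j ∈ Finset.range k, C (((p / 2).choose j : ℕ) : ZMod p) * (X ^ 2 - 1) ^ j := by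
  have hm : (X ^ 2 - 1 : (ZMod p)[X]).Monic := by
    simpa using monic_X_pow_sub_C (1 : ZMod p) (n := 2) (by norm_num)
  have hdg : (X ^ 2 - 1 : (ZMod p)[X]).natDegree = 2 := by
    simpa using natDegree_X_pow_sub_C (r := (1 : ZMod p)) (n := 2)
  have hPm : (Pk p k).Monic := hm.pow k
  have hPd : (Pk p k).natDegree = 2 * k := by
    unfold Pk; rw [hm.natDegree_pow, hdg]; ring
  rcases Nat.eq_zero_or_pos k with rfl | hk
  · simp [Rk, Pk]
  have hp2 : p = 2 * (p / 2) + 1 := by obtain ⟨m, hm⟩ := hodd; omega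
  obtain ⟨r, hr⟩ : ∃ r, p / 2 + 1 = k + r := ⟨p / 2 + 1 - k, by omega⟩
  have hexp : (X : (ZMod p)[X]) ^ p = X * ∑ j ∈ Finset.range (p / 2 + 1),
      C (((p / 2).choose j : ℕ) : ZMod p) * (X ^ 2 - 1) ^ j := by
    have h := add_pow (X ^ 2 - 1 : (ZMod p)[X]) 1 (p / 2)
    rw [sub_add_cancel] at h
    have hXp : (X : (ZMod p)[X]) ^ p = X ^ (2 * (p / 2) + 1) := congrArg _ hp2
    rw [hXp, pow_succ, pow_mul, h, mul_comm]
    congr 1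
    apply Finset.sum_congr rfl
    intro j _
    simp [mul_comm]
  rw [hr, Finset.sum_range_add] at hexp
  refine (div_modByMonic_unique (X * ∑ j ∈ Finset.range r,
    C (((p / 2).choose (k + j) : ℕ) : ZMod p) * (X ^ 2 - 1) ^ j) _ hPm ⟨?_, ?_⟩).2
  · rw [hexp, Pk, mul_add]
    congr 1
    rw [mul_left_comm, Finset.mul_sum]
    congr 1
    apply Finset.sum_congr rfl
    intro j _
    ring
  · rw [degree_eq_natDegree hPm.ne_zero, hPd]
    refine lt_of_le_of_lt (degree_le_of_natDegree_le (n := 2 * k - 1) ?_)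
      (by exact_mod_cast (by omega))
    have h1 : (∑ j ∈ Finset.range k, C (((p / 2).choose j : ℕ) : ZMod p) *
        (X ^ 2 - 1) ^ j : (ZMod p)[X]).natDegree ≤ 2 * k - 2 := by
      apply natDegree_sum_le_of_forall_le
      intro j hj
      rw [Finset.mem_range] at hj
      refine (natDegree_C_mul_le _ _).trans ?_
      rw [hm.natDegree_pow, hdg]; omega
    refine natDegree_mul_le.trans ?_
    rw [natDegree_X]; omega

lemma Rk_ff (p n : ℕ) [Fact (Nat.Prime p)] (hodd : Odd p) (hk2 : 2 * (n + 1) < p) :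
    Rk p (n + 1) = C (((p / 2).choose n : ℕ) : ZMod p) * ff p (n + 1) (2 * n + 1) := by
  have hR := Rk_eq p (n + 1) hodd hk2
  set c : ZMod p := (((p / 2).choose n : ℕ) : ZMod p) with hc
  have hm : (X ^ 2 - 1 : (ZMod p)[X]).Monic := by
    simpa using monic_X_pow_sub_C (1 : ZMod p) (n := 2) (by norm_num)
  have hdg : (X ^ 2 - 1 : (ZMod p)[X]).natDegree = 2 := by
    simpa using natDegree_X_pow_sub_C (r := (1 : ZMod p)) (n := 2)
  -- decomposition
  have hdeg : ∀ q : (ZMod p)[X], q.Monic → q.natDegree = 2 * n + 1 →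
      (q - X ^ (2 * n + 1)).natDegree ≤ 2 * n := by
    intro q hq hqd
    by_cases h0 : q - X ^ (2 * n + 1) = 0
    · rw [h0]; simp
    have := degree_sub_lt_left (p := q) (q := X ^ (2 * n + 1))
      (by rw [degree_eq_natDegree hq.ne_zero, hqd, degree_X_pow])
      hq.ne_zero (by rw [hq.leadingCoeff, (monic_X_pow _).leadingCoeff])
    have := natDegree_lt_natDegree h0 this
    omega
  obtain ⟨fm, fd⟩ := (ff_monic p (n + 1) (2 * n)).2
  set F := ff p (n + 1) (2 * n + 1) with hF
  set G := X * (X ^ 2 - 1 : (ZMod p)[X]) ^ n with hG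
  have hGm : G.Monic := monic_X.mul (hm.pow n)
  have hGd : G.natDegree = 2 * n + 1 := by
    rw [hG, monic_X.natDegree_mul (hm.pow n), hm.natDegree_pow, hdg, natDegree_X]; ring
  set D := Rk p (n + 1) - C c * F with hD
  have hDdeg : D.natDegree ≤ 2 * n := by
    have h1 : (X * ∑ j ∈ Finset.range n, C (((p / 2).choose j : ℕ) : ZMod p) *
        (X ^ 2 - 1) ^ j : (ZMod p)[X]).natDegree ≤ 2 * n := by
      rcases Nat.eq_zero_or_pos n with rfl | hn
      · simp
      have h1 : (∑ j ∈ Finset.range n, C (((p / 2).choose j : ℕ) : ZMod p) *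
          (X ^ 2 - 1) ^ j : (ZMod p)[X]).natDegree ≤ 2 * n - 2 := by
        apply natDegree_sum_le_of_forall_le
        intro j hj
        rw [Finset.mem_range] at hj
        refine (natDegree_C_mul_le _ _).trans ?_
        rw [hm.natDegree_pow, hdg]; omega
      refine natDegree_mul_le.trans ?_
      rw [natDegree_X]; omega
    have e : D = (X * ∑ j ∈ Finset.range n, C (((p / 2).choose j : ℕ) : ZMod p) *
        (X ^ 2 - 1) ^ j) + C c * ((G - X ^ (2 * n + 1)) - (F - X ^ (2 * n + 1))) := by
      rw [hD, hR, Finset.sum_range_succ, hG]; ring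
    rw [e]
    refine (natDegree_add_le _ _).trans (max_le h1 ((natDegree_C_mul_le _ _).trans ?_))
    exact (natDegree_sub_le _ _).trans (max_le (hdeg _ hGm hGd) (hdeg _ fm fd))
  have hDdvd : (X ^ 2 - 1 : (ZMod p)[X]) ^ n ∣ derivative D := by
    rw [hD, derivative_sub]
    apply dvd_sub
    · have h1 : Rk p (n + 1) = X ^ p - Pk p (n + 1) * A1 p (n + 1) := by
        rw [eq_sub_iff_add_eq]
        exact modByMonic_add_div _ _
      rw [h1, Pk]
      simp only [derivative_sub, derivative_mul, derivative_X_pow, derivative_pow_succ]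
      simp only [CharP.cast_eq_zero, map_zero, zero_mul, zero_sub, dvd_neg]
      exact dvd_add (((Dvd.intro_left _ rfl).mul_right _).mul_right _)
        ((pow_dvd_pow _ (Nat.le_succ n)).mul_right _)
    · have hU := (ladder p (n + 1) hk2 (2 * n + 1) (by omega)).2
      have e : 2 * n + 1 + 1 = 2 * (n + 1) := by ring
      have e2 : 2 * ((n + 1 : ℕ) : ZMod p) - ((2 * n + 1 : ℕ) : ZMod p) - 1 = 0 := by
        push_cast; ring
      rw [e, e2, ff_top p (n + 1) (by omega) hk2, ← hF, map_zero, zero_mul, zero_mul, add_zero, Pk,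
        pow_succ' _ n] at hU
      rw [mul_left_comm (C _)] at hU
      have hU' := mul_left_cancel₀ hm.ne_zero hU
      rw [derivative_C_mul, hU']
      exact (dvd_mul_left _ _).mul_left _
  have hD0 : derivative D = 0 := by
    by_contra hne
    have h1 := natDegree_le_of_dvd hDdvd hne
    rw [hm.natDegree_pow, hdg] at h1
    have h2 : D.natDegree ≠ 0 := by
      intro h
      exact hne (derivative_of_natDegree_zero h)
    have h3 := natDegree_derivative_lt h2
    omega
  have hconst : D = 0 := by
    ext i
    rcases Nat.eq_zero_or_pos i with rfl | hi
    · rw [coeff_zero_eq_eval_zero, hD, hR, eval_sub, eval_mul, eval_mul, hF, ff_eval]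
      simp
    · obtain ⟨j, rfl⟩ : ∃ j, i = j + 1 := ⟨i - 1, by omega⟩
      by_cases hj : j + 1 ≤ 2 * n
      · have h := congrArg (fun q => coeff q j) hD0
        simp only [coeff_derivative, coeff_zero] at h
        have := nat_ne p (j + 1) (by omega) (by omega)
        push_cast at this
        rw [coeff_zero]
        exact (mul_eq_zero.mp h).resolve_right this
      · rw [coeff_eq_zero_of_natDegree_lt (by omega), coeff_zero]
  exact sub_eq_zero.mp hconst

lemma choose_eq (p : ℕ) [Fact (Nat.Prime p)] (hodd : Odd p) (n : ℕ) (hn : 2 * n < p) :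
    (((p / 2).choose n : ℕ) : ZMod p) =
      (-1) ^ n * ∏ i ∈ Finset.Icc 1 n, (1 - (2 * (i : ZMod p))⁻¹) := by
  induction n with
  | zero => simp
  | succ n ih =>
    have h2 : (2 : ZMod p) ≠ 0 := by
      have := nat_ne p 2 (by omega) (by omega)
      exact_mod_cast this
    have hn1 := nat_ne p (n + 1) (by omega) (by omega)
    have hp2 : p = 2 * (p / 2) + 1 := by obtain ⟨m, hm⟩ := hodd; omega
    have hh : 2 * ((p / 2 : ℕ) : ZMod p) = -1 := by
      have := congrArg (Nat.cast (R := ZMod p)) hp2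
      rw [CharP.cast_eq_zero] at this
      push_cast at this
      linear_combination -this
    have h := congrArg (Nat.cast (R := ZMod p)) (Nat.choose_succ_right_eq (p / 2) n)
    rw [Nat.cast_mul, Nat.cast_mul, Nat.cast_sub (by omega)] at h
    rw [Finset.prod_Icc_succ_top (by omega), pow_succ]
    have ih' := ih (by omega)
    apply mul_right_cancel₀ hn1
    rw [h, ih']
    have e : (1 - (2 * ((n + 1 : ℕ) : ZMod p))⁻¹) * ((n + 1 : ℕ) : ZMod p) =
      (2 * ((n + 1 : ℕ) : ZMod p) - 1) * 2⁻¹ := by field_simp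
    have e' : ((p / 2 : ℕ) : ZMod p) - n = -((2 * ((n + 1 : ℕ) : ZMod p) - 1) * 2⁻¹) := by
      field_simp; push_cast; linear_combination hh
    rw [e', ← e]; ring

lemma cfrac_eq (p k : ℕ) [Fact (Nat.Prime p)] (hk2 : 2 * k < p) (w : ℕ → ZMod p)
    (hwne : ∀ i, 1 ≤ i → i ≤ 2 * k → w i ≠ 0)
    (hwrec : ∀ i, 1 ≤ i → i ≤ 2 * k - 1 →
      w (i + 1) * w i =
        (2 * (k : ZMod p) - 2 * (i : ZMod p) - 1) * (2 * (k : ZMod p) - 2 * (i : ZMod p) + 1)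
          * ((i : ZMod p) * (2 * (k : ZMod p) - (i : ZMod p)))⁻¹)
    (m s : ℕ) (hms : m + 1 + s = 2 * k) :
    cfrac ((List.range (m + 1)).map fun i =>
      algebraMap (Polynomial (ZMod p)) (RatFunc (ZMod p)) (C (w (s + i + 1)) * X)) =
    algebraMap (Polynomial (ZMod p)) (RatFunc (ZMod p)) (C (w (s + 1)) * ff p k (m + 1)) /
    algebraMap (Polynomial (ZMod p)) (RatFunc (ZMod p)) (ff p k m) := by
  induction m generalizing s with
  | zero => simp [cfrac, ff]
  | succ m ih =>
    have ih' := ih (s + 1) (by omega)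
    have hl : ((List.range (m + 1 + 1)).map fun i =>
      algebraMap (Polynomial (ZMod p)) (RatFunc (ZMod p)) (C (w (s + i + 1)) * X)) =
      algebraMap (Polynomial (ZMod p)) (RatFunc (ZMod p)) (C (w (s + 1)) * X) ::
      ((List.range (m + 1)).map fun i =>
      algebraMap (Polynomial (ZMod p)) (RatFunc (ZMod p)) (C (w (s + 1 + i + 1)) * X)) := by
      rw [List.range_succ_eq_map, List.map_cons, List.map_map]
      congr 1
      apply List.map_congr_left
      intro i _
      simp only [Function.comp]
      congr 4
      omega
    have hcons : ∀ (a : RatFunc (ZMod p)) l, l ≠ [] → cfrac (a :: l) = a + (cfrac l)⁻¹ := by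
      intro a l hl
      cases l with
      | nil => exact absurd rfl hl
      | cons b l => rfl
    rw [hl, hcons _ _ (by simp), ih']
    have hw1 := hwne (s + 1 + 1) (by omega) (by omega)
    have hrec := hwrec (s + 1) (by omega) (by omega)
    have hb : w (s + 1 + 1) * w (s + 1) * bt p k (m + 1) = 1 := by
      have hs : ((s + 1 : ℕ) : ZMod p) = 2 * k - ((m + 1 : ℕ) : ZMod p) := by
        have := congrArg (Nat.cast (R := ZMod p)) hms
        push_cast at this ⊢
        linear_combination this
      have n1 := nat_ne p (m + 1) (by omega) (by omega)
      have n2 := nat_ne p (s + 1) (by omega) (by omega)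
      have d1 := den1 p k (m + 1) hk2 (by omega) (by omega)
      have d2 := den2 p k (m + 1) hk2 (by omega)
      rw [hrec, bt, hs]
      rw [hs] at n2
      generalize ((m + 1 : ℕ) : ZMod p) = M at *
      have e1 : 2 * (k : ZMod p) - 2 * (2 * k - M) - 1 = 2 * M - 2 * k - 1 := by ring
      have e2 : 2 * (k : ZMod p) - 2 * (2 * k - M) + 1 = 2 * M - 2 * k + 1 := by ring
      have e3 : 2 * (k : ZMod p) - (2 * k - M) = M := by ring
      rw [e1, e2, e3]
      exact aux3 _ _ _ _ n1 n2 d1 d2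
    have hf : ff p k (m + 1 + 1) = X * ff p k (m + 1) + C (bt p k (m + 1)) * ff p k m := rfl
    have inj := FaithfulSMul.algebraMap_injective (ZMod p)[X] (RatFunc (ZMod p))
    have f1 : algebraMap (Polynomial (ZMod p)) (RatFunc (ZMod p)) (ff p k (m + 1)) ≠ 0 := by
      rw [Ne, map_eq_zero_iff _ inj]
      exact (ff_monic p k m).2.1.ne_zero
    have c1 : algebraMap (Polynomial (ZMod p)) (RatFunc (ZMod p)) (C (w (s + 1 + 1))) ≠ 0 := by
      rw [Ne, map_eq_zero_iff _ inj]
      exact C_ne_zero.mpr hw1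
    have hb' := congrArg (fun z => algebraMap (Polynomial (ZMod p)) (RatFunc (ZMod p)) (C z)) hb
    simp only [map_mul, map_one] at hb'
    rw [hf]
    simp only [map_mul, map_add]
    rw [inv_div, eq_div_iff f1]
    field_simp
    linear_combination (-algebraMap (Polynomial (ZMod p)) (RatFunc (ZMod p)) (ff p k m)) * hb'

theorem stmt_3 (p k : ℕ) [Fact (Nat.Prime p)] (hodd : Odd p)
    (hk1 : 1 ≤ k) (hk2 : 2 * k < p)
    (ω : ZMod p)
    (hω : ω = (-1) ^ (k - 1) * ∏ i ∈ Finset.Icc 1 k, (1 - (2 * (i : ZMod p))⁻¹))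
    (w : ℕ → ZMod p)
    (hwne : ∀ i, 1 ≤ i → i ≤ 2 * k → w i ≠ 0)
    (hw1 : w 1 = (2 * (k : ZMod p) - 1) * (2 * (k : ZMod p) * ω)⁻¹)
    (hwrec : ∀ i, 1 ≤ i → i ≤ 2 * k - 1 →
      w (i + 1) * w i =
        (2 * (k : ZMod p) - 2 * (i : ZMod p) - 1) * (2 * (k : ZMod p) - 2 * (i : ZMod p) + 1)
          * ((i : ZMod p) * (2 * (k : ZMod p) - (i : ZMod p)))⁻¹) :
    algebraMap (Polynomial (ZMod p)) (RatFunc (ZMod p)) ((X : Polynomial (ZMod p)) ^ p)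
        / algebraMap (Polynomial (ZMod p)) (RatFunc (ZMod p)) (Pk p k)
      = cfrac (algebraMap (Polynomial (ZMod p)) (RatFunc (ZMod p)) (A1 p k)
          :: (List.range (2 * k)).map fun i =>
              algebraMap (Polynomial (ZMod p)) (RatFunc (ZMod p)) (C (w (i + 1)) * X)) ∧
    algebraMap (Polynomial (ZMod p)) (RatFunc (ZMod p)) (Pk p k)
        / algebraMap (Polynomial (ZMod p)) (RatFunc (ZMod p)) (Rk p k)
      = cfrac ((List.range (2 * k)).map fun i =>
          algebraMap (Polynomial (ZMod p)) (RatFunc (ZMod p)) (C (w (i + 1)) * X)) := by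
  obtain ⟨n, rfl⟩ : ∃ n, k = n + 1 := ⟨k - 1, by omega⟩
  have inj := FaithfulSMul.algebraMap_injective (ZMod p)[X] (RatFunc (ZMod p))
  have hcf := cfrac_eq p (n + 1) hk2 w hwne hwrec (2 * n + 1) 0 (by ring)
  simp only [zero_add] at hcf
  rw [show 2 * n + 1 + 1 = 2 * (n + 1) by ring, ff_top p (n + 1) hk1 hk2] at hcf
  have hR := Rk_ff p n hodd hk2
  have hch := choose_eq p hodd n (by omega)
  set c : ZMod p := (((p / 2).choose n : ℕ) : ZMod p) with hc
  have hwc : w 1 * c = 1 := by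
    have h1 := hwne 1 le_rfl (by omega)
    have h2 : (2 : ZMod p) ≠ 0 := by
      have := nat_ne p 2 (by omega) (by omega)
      exact_mod_cast this
    have hn1 := nat_ne p (n + 1) (by omega) (by omega)
    have ho : ω = c * (1 - (2 * ((n + 1 : ℕ) : ZMod p))⁻¹) := by
      rw [hω, hch, Finset.prod_Icc_succ_top (by omega), Nat.add_sub_cancel]; ring
    have ho2 : 2 * ((n + 1 : ℕ) : ZMod p) * ω = c * (2 * ((n + 1 : ℕ) : ZMod p) - 1) := by
      rw [ho]; field_simp
    rw [ho2] at hw1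
    have h3 : (2 * ((n + 1 : ℕ) : ZMod p) - 1) ≠ 0 := by
      intro h; rw [h] at hw1; simp at hw1; exact h1 hw1
    have h4 : c ≠ 0 := by
      intro h; rw [h] at hw1; simp at hw1; exact h1 hw1
    rw [hw1]; field_simp
  have hwc' := congrArg (fun z => algebraMap (Polynomial (ZMod p)) (RatFunc (ZMod p)) (C z)) hwc
  simp only [map_mul, map_one] at hwc'
  have c0 : algebraMap (Polynomial (ZMod p)) (RatFunc (ZMod p)) (C c) ≠ 0 :=
    right_ne_zero_of_mul_eq_one hwc'
  have F0 : algebraMap (Polynomial (ZMod p)) (RatFunc (ZMod p)) (ff p (n + 1) (2 * n + 1)) ≠ 0 := by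
    rw [Ne, map_eq_zero_iff _ inj]
    exact (ff_monic p (n + 1) (2 * n)).2.1.ne_zero
  have P0 : algebraMap (Polynomial (ZMod p)) (RatFunc (ZMod p)) (Pk p (n + 1)) ≠ 0 := by
    rw [Ne, map_eq_zero_iff _ inj, ← ff_top p (n + 1) hk1 hk2]
    exact (ff_monic p (n + 1) (2 * (n + 1))).1.1.ne_zero
  have second : algebraMap (Polynomial (ZMod p)) (RatFunc (ZMod p)) (Pk p (n + 1))
        / algebraMap (Polynomial (ZMod p)) (RatFunc (ZMod p)) (Rk p (n + 1))
      = cfrac ((List.range (2 * (n + 1))).map fun i =>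
          algebraMap (Polynomial (ZMod p)) (RatFunc (ZMod p)) (C (w (i + 1)) * X)) := by
    rw [hcf, hR]
    simp only [map_mul]
    rw [div_eq_div_iff (mul_ne_zero c0 F0) F0]
    linear_combination (-algebraMap (Polynomial (ZMod p)) (RatFunc (ZMod p)) (Pk p (n + 1)) *
      algebraMap (Polynomial (ZMod p)) (RatFunc (ZMod p)) (ff p (n + 1) (2 * n + 1))) * hwc'
  refine ⟨?_, second⟩
  have hcons : ∀ (a : RatFunc (ZMod p)) l, l ≠ [] → cfrac (a :: l) = a + (cfrac l)⁻¹ := by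
    intro a l hl
    cases l with
    | nil => exact absurd rfl hl
    | cons b l => rfl
  rw [hcons _ _ (by simp), ← second, inv_div, div_eq_iff P0, add_mul, div_mul_cancel₀ _ P0,
    ← map_mul, ← map_add]
  congr 1
  rw [add_comm, mul_comm]
  exact (modByMonic_add_div _ _).symm
end
end

section
/- The elements w_1, ..., w_{2k} ∈ F_p^* satisfy the antisymmetry relation w_{2k+1−i} = −w_i for all 1 ≤ i ≤ 2k. -/
open Polynomial

noncomputable section

theorem stmt_4 (p k : ℕ) [Fact (Nat.Prime p)] (hodd : Odd p)
    (hk1 : 1 ≤ k) (hk2 : 2 * k < p)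
    (ω : ZMod p)
    (hω : ω = (-1) ^ (k - 1) * ∏ i ∈ Finset.Icc 1 k, (1 - (2 * (i : ZMod p))⁻¹))
    (w : ℕ → ZMod p)
    (hwne : ∀ i, 1 ≤ i → i ≤ 2 * k → w i ≠ 0)
    (hw1 : w 1 = (2 * (k : ZMod p) - 1) * (2 * (k : ZMod p) * ω)⁻¹)
    (hwrec : ∀ i, 1 ≤ i → i ≤ 2 * k - 1 →
      w (i + 1) * w i =
        (2 * (k : ZMod p) - 2 * (i : ZMod p) - 1) * (2 * (k : ZMod p) - 2 * (i : ZMod p) + 1)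
          * ((i : ZMod p) * (2 * (k : ZMod p) - (i : ZMod p)))⁻¹) :
    ∀ i, 1 ≤ i → i ≤ 2 * k → w (2 * k + 1 - i) = - w i := by
  obtain ⟨m, rfl⟩ : ∃ m, k = m + 1 := ⟨k - 1, by omega⟩
  set K : ZMod p := ((m + 1 : ℕ) : ZMod p) with hK
  have hKm : K = (m : ZMod p) + 1 := by rw [hK]; push_cast; ring
  have castne : ∀ n : ℕ, 1 ≤ n → n < p → (n : ZMod p) ≠ 0 := by
    intro n h1 h2 h
    rw [ZMod.natCast_eq_zero_iff] at h
    exact absurd (Nat.le_of_dvd (by omega) h) (by omega)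
  -- the recursion cleared of denominators
  have hne : ∀ i, 1 ≤ i → i ≤ 2 * m + 1 → (2 * K - 2 * (i : ZMod p) - 1 ≠ 0) ∧
      (2 * K - 2 * (i : ZMod p) + 1 ≠ 0) ∧ (i : ZMod p) * (2 * K - i) ≠ 0 := by
    intro i h1 h2
    have h := hwrec i h1 (by omega)
    have h3 := mul_ne_zero (hwne (i + 1) (by omega) (by omega)) (hwne i h1 (by omega))
    rw [h] at h3
    refine ⟨fun h0 => h3 (by rw [h0]; ring), fun h0 => h3 (by rw [h0]; ring),
      fun h0 => h3 (by rw [h0]; simp)⟩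
  have hrec : ∀ i, 1 ≤ i → i ≤ 2 * m + 1 →
      w (i + 1) * w i * ((i : ZMod p) * (2 * K - i)) =
        (2 * K - 2 * (i : ZMod p) - 1) * (2 * K - 2 * (i : ZMod p) + 1) := by
    intro i h1 h2
    rw [hwrec i h1 (by omega), inv_mul_cancel_right₀ (hne i h1 h2).2.2]
  -- telescoping
  have tele : ∀ j, j ≤ m → w (2 * j + 2) * w 1 *
      ∏ i ∈ Finset.range (j + 1), ((2 * (i : ZMod p) + 1) * (2 * K - (2 * i + 1))) =
      (2 * K - 4 * j - 3) * (2 * K - 1) *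
        ∏ i ∈ Finset.range j, ((2 * (i : ZMod p) + 2) * (2 * K - (2 * i + 2))) := by
    intro j
    induction j with
    | zero =>
      intro _
      have h := hrec 1 le_rfl (by omega)
      simp only [Nat.cast_one] at h
      simp only [Finset.prod_range_succ, Finset.prod_range_zero, Nat.cast_zero, Nat.mul_zero,
        Nat.zero_add]
      linear_combination h
    | succ j ih =>
      intro hj
      have ih := ih (by omega)
      have e1 := hrec (2 * j + 2) (by omega) (by omega)
      have e2 := hrec (2 * j + 3) (by omega) (by omega)
      have n1 := (hne (2 * j + 2) (by omega) (by omega)).1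
      have n2 := (hne (2 * j + 2) (by omega) (by omega)).2.1
      have n3 := hwne (2 * j + 3) (by omega) (by omega)
      rw [Finset.prod_range_succ _ (j + 1), Finset.prod_range_succ (fun i : ℕ => (2 * (i : ZMod p) + 2) * (2 * K - (2 * i + 2))) j]
      generalize (∏ i ∈ Finset.range (j + 1), ((2 * (i : ZMod p) + 1) * (2 * K - (2 * i + 1)))) = P at *
      generalize (∏ i ∈ Finset.range j, ((2 * (i : ZMod p) + 2) * (2 * K - (2 * i + 2)))) = Q at *
      rw [show 2 * (j + 1) + 2 = 2 * j + 3 + 1 by ring]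
      rw [show 2 * j + 2 + 1 = 2 * j + 3 by ring] at e1
      push_cast at *
      generalize w (2 * j + 3 + 1) = a at *
      generalize w (2 * j + 3) = b at *
      generalize w (2 * j + 2) = c at *
      generalize (j : ZMod p) = x at *
      have key : a * ((2 * x + 3) * (2 * K - (2 * x + 3))) * (2 * K - 2 * (2 * x + 2) + 1)
          = (2 * K - 2 * (2 * x + 3) - 1) * (c * ((2 * x + 2) * (2 * K - (2 * x + 2)))) := by
        apply mul_left_cancel₀ n3
        linear_combination (2 * K - 2 * (2 * x + 2) + 1) * e2 - (2 * K - 2 * (2 * x + 3) - 1) * e1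
      apply mul_left_cancel₀ n2
      linear_combination w 1 * P * key + (2 * K - 2 * (2 * x + 3) - 1) * ((2 * x + 2) * (2 * K - (2 * x + 2))) * ih
  have ht := tele m le_rfl
  rw [Finset.prod_mul_distrib, Finset.prod_mul_distrib] at ht
  have r1 : ∏ i ∈ Finset.range (m + 1), (2 * K - (2 * (i : ZMod p) + 1)) =
      ∏ i ∈ Finset.range (m + 1), (2 * (i : ZMod p) + 1) := by
    rw [← Finset.prod_range_reflect]
    refine Finset.prod_congr rfl fun i hi => ?_
    have hi := Finset.mem_range.1 hi
    rw [show m + 1 - 1 - i = m - i by omega, Nat.cast_sub (by omega), hKm]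
    ring
  have r2 : ∏ i ∈ Finset.range m, (2 * K - (2 * (i : ZMod p) + 2)) =
      ∏ i ∈ Finset.range m, (2 * (i : ZMod p) + 2) := by
    rw [← Finset.prod_range_reflect]
    refine Finset.prod_congr rfl fun i hi => ?_
    have hi := Finset.mem_range.1 hi
    rw [show m - 1 - i = m - (i + 1) by omega, Nat.cast_sub (by omega), hKm]
    push_cast
    ring
  rw [r1, r2] at ht
  -- the value of ω
  have hωE : ω * ∏ i ∈ Finset.range (m + 1), (2 * (i : ZMod p) + 2) =
      (-1) ^ m * ∏ i ∈ Finset.range (m + 1), (2 * (i : ZMod p) + 1) := by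
    rw [hω, Nat.add_sub_cancel, mul_assoc]
    congr 1
    have : Finset.Icc 1 (m + 1) = Finset.Ico 1 (m + 2) := by ext; simp; omega
    rw [this, Finset.prod_Ico_eq_prod_range, show m + 2 - 1 = m + 1 by omega,
      ← Finset.prod_mul_distrib]
    refine Finset.prod_congr rfl fun i hi => ?_
    have hi := Finset.mem_range.1 hi
    have h0 := castne (2 * (1 + i)) (by omega) (by omega)
    push_cast at h0 ⊢
    rw [sub_mul, show (2 * (i : ZMod p) + 2) = 2 * (1 + i) by ring, inv_mul_cancel₀ h0]
    ring
  rw [Finset.prod_range_succ, show 2 * (m : ZMod p) + 2 = 2 * K by rw [hKm]; ring] at hωE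
  have hOne : ∏ i ∈ Finset.range (m + 1), (2 * (i : ZMod p) + 1) ≠ 0 := by
    rw [Finset.prod_ne_zero_iff]
    intro i hi
    have hi := Finset.mem_range.1 hi
    have h0 := castne (2 * i + 1) (by omega) (by omega)
    exact_mod_cast h0
  generalize (∏ i ∈ Finset.range (m + 1), (2 * (i : ZMod p) + 1)) = O at *
  generalize (∏ i ∈ Finset.range m, (2 * (i : ZMod p) + 2)) = E at *
  have w1ne := hwne 1 le_rfl (by omega)
  have hKω : 2 * K * ω ≠ 0 := by
    intro h0
    apply w1ne
    rw [hw1, h0]; simp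
  have hw1' : w 1 * (2 * K * ω) = 2 * K - 1 := by
    rw [hw1, inv_mul_cancel_right₀ hKω]
  have hs : ((-1 : ZMod p) ^ m) ^ 2 = 1 := by
    rw [← pow_mul, mul_comm, pow_mul]; simp
  have hsq : w 1 ^ 2 * O ^ 2 = (2 * K - 1) ^ 2 * E ^ 2 := by
    have h1 : w 1 * ((-1) ^ m * O) = (2 * K - 1) * E := by
      rw [← hωE, ← hw1']; ring
    rw [← mul_pow (2 * K - 1), ← h1]
    linear_combination (- w 1 ^ 2 * O ^ 2) * hs
  have hlast : w (2 * m + 2) = - w 1 := by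
    apply mul_right_cancel₀ (mul_ne_zero w1ne (pow_ne_zero 2 hOne))
    rw [show (m : ZMod p) = K - 1 by rw [hKm]; ring] at ht
    linear_combination ht + hsq
  -- propagate
  intro i hi
  induction i, hi using Nat.le_induction with
  | base =>
    intro _
    rw [show 2 * (m + 1) + 1 - 1 = 2 * m + 2 by omega, hlast]
  | succ i hi ih =>
    intro hi2
    have ih := ih (by omega)
    have e1 := hrec i hi (by omega)
    have e2 := hrec (2 * m + 2 - i) (by omega) (by omega)
    have n1 := (hne i hi (by omega)).2.2
    rw [Nat.cast_sub (by omega), show 2 * m + 2 - i + 1 = 2 * (m + 1) + 1 - i by omega, ih] at e2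
    rw [show 2 * (m + 1) + 1 - (i + 1) = 2 * m + 2 - i by omega]
    have hc : ((2 * m + 2 : ℕ) : ZMod p) = 2 * K := by rw [hKm]; push_cast; ring
    rw [hc] at e2
    apply mul_right_cancel₀ (mul_ne_zero (hwne i hi (by omega)) n1)
    linear_combination e1 - e2
end
end

section
/- In the extremal case k = (p−1)/2 we have ω_k = −1 and w_i = 2·(−1)^i in F_p for all 1 ≤ i ≤ 2k; that is, the word W equals −2T, 2T, −2T, ..., 2T. -/
open Polynomial

noncomputable section

theorem stmt_5 (p k : ℕ) [Fact (Nat.Prime p)] (hodd : Odd p)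
    (hk1 : 1 ≤ k) (hpk : p = 2 * k + 1)
    (ω : ZMod p)
    (hω : ω = (-1) ^ (k - 1) * ∏ i ∈ Finset.Icc 1 k, (1 - (2 * (i : ZMod p))⁻¹))
    (w : ℕ → ZMod p)
    (hwne : ∀ i, 1 ≤ i → i ≤ 2 * k → w i ≠ 0)
    (hw1 : w 1 = (2 * (k : ZMod p) - 1) * (2 * (k : ZMod p) * ω)⁻¹)
    (hwrec : ∀ i, 1 ≤ i → i ≤ 2 * k - 1 →
      w (i + 1) * w i =
        (2 * (k : ZMod p) - 2 * (i : ZMod p) - 1) * (2 * (k : ZMod p) - 2 * (i : ZMod p) + 1)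
          * ((i : ZMod p) * (2 * (k : ZMod p) - (i : ZMod p)))⁻¹) :
    ω = -1 ∧ ∀ i, 1 ≤ i → i ≤ 2 * k → w i = 2 * (-1 : ZMod p) ^ i := by
  have hp0 : (2 * (k : ZMod p) + 1) = 0 := by
    have h : ((2 * k + 1 : ℕ) : ZMod p) = 0 := by rw [← hpk]; exact ZMod.natCast_self p
    exact_mod_cast h
  have hne : ∀ i : ℕ, 1 ≤ i → i ≤ 2 * k → (i : ZMod p) ≠ 0 := by
    intro i h1 h2 h
    rw [ZMod.natCast_eq_zero_iff] at h
    have := Nat.le_of_dvd (by omega) h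
    omega
  have h2 : (2 : ZMod p) ≠ 0 := by
    have := hne 2 (by omega) (by omega)
    exact_mod_cast this
  have h2k : 2 * (k : ZMod p) = -1 := by linear_combination hp0
  have hprod : ∏ i ∈ Finset.Icc 1 k, (1 - (2 * (i : ZMod p))⁻¹) = (-1) ^ k := by
    have e1 : ∀ i ∈ Finset.Icc 1 k, (1 - (2 * (i : ZMod p))⁻¹)
        = (-1) * ((2 * ((k + 1 - i : ℕ) : ZMod p)) * (2 * (i : ZMod p))⁻¹) := by
      intro i hi
      rw [Finset.mem_Icc] at hi
      have hi0 := hne i hi.1 (by omega)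
      rw [Nat.cast_sub (by omega)]
      push_cast
      field_simp
      linear_combination hp0
    have e2 : ∏ i ∈ Finset.Icc 1 k, (2 * ((k + 1 - i : ℕ) : ZMod p))
        = ∏ i ∈ Finset.Icc 1 k, (2 * (i : ZMod p)) := by
      refine Finset.prod_bij' (fun i _ => k + 1 - i) (fun i _ => k + 1 - i) ?_ ?_ ?_ ?_ ?_
      · intro i hi; simp only [Finset.mem_Icc] at hi ⊢; omega
      · intro i hi; simp only [Finset.mem_Icc] at hi ⊢; omega
      · intro i hi; simp only [Finset.mem_Icc] at hi ⊢; omega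
      · intro i hi; simp only [Finset.mem_Icc] at hi ⊢; omega
      · intro i hi; rfl
    rw [Finset.prod_congr rfl e1, Finset.prod_mul_distrib, Finset.prod_mul_distrib, e2,
      ← Finset.prod_mul_distrib, Finset.prod_eq_one (s := Finset.Icc 1 k)
        (f := fun i : ℕ => (2 * (i : ZMod p)) * (2 * (i : ZMod p))⁻¹)]
    · simp
    · intro i hi
      rw [Finset.mem_Icc] at hi
      exact mul_inv_cancel₀ (mul_ne_zero h2 (hne i hi.1 (by omega)))
  have hω1 : ω = -1 := by
    rw [hω, hprod, ← pow_add]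
    exact Odd.neg_one_pow ⟨k - 1, by omega⟩
  refine ⟨hω1, ?_⟩
  intro i hi
  induction i, hi using Nat.le_induction with
  | base =>
    intro _
    rw [hw1, hω1, h2k]
    norm_num
  | succ n hn ih =>
    intro hle
    have ihn := ih (by omega)
    have hr := hwrec n hn (by omega)
    have hn0 := hne n hn (by omega)
    have hn1 := hne (n + 1) (by omega) hle
    push_cast at hn1
    have hv : w (n + 1) * w n = -4 := by
      rw [hr, h2k]
      have hd : (n : ZMod p) * (-1 - (n : ZMod p)) ≠ 0 := by
        refine mul_ne_zero hn0 ?_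
        intro h
        exact hn1 (by linear_combination -h)
      rw [← div_eq_mul_inv, div_eq_iff hd]
      ring
    have hwn := hwne n hn (by omega)
    apply mul_right_cancel₀ hwn
    rw [hv, ihn]
    have hs : ((-1 : ZMod p) ^ n) * (-1) ^ n = 1 := by
      rw [← pow_add]; exact Even.neg_one_pow ⟨n, rfl⟩
    rw [pow_succ]
    linear_combination 4 * hs
end
end

section
/- The continuants built from the word W satisfy, in F_p[T]: ⟨W⟩ = ⟨w_1T, ..., w_{2k}T⟩ = (−1)^k·P_k, ⟨W'⟩ = ⟨w_2T, ..., w_{2k}T⟩ = (−1)^k·R_k, and ⟨W''⟩ = ⟨w_1T, ..., w_{2k−1}T⟩ = (−1)^{k+1}·R_k. -/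
open Polynomial

noncomputable section

/-- The pair of consecutive continuants, with a general starting pair. -/
def stp {R : Type*} [CommRing R] (a : ℕ → R) (s : R × R) : ℕ → R × R
  | 0 => s
  | n + 1 => (a n * (stp a s n).1 + (stp a s n).2, (stp a s n).1)

lemma foldl_stp {R : Type*} [CommRing R] (a : ℕ → R) (s : R × R) (n : ℕ) :
    ((List.range n).map a).foldl (fun q a => (a * q.1 + q.2, q.1)) s = stp a s n := by
  induction n with
  | zero => rfl
  | succ n ih => rw [List.range_succ, List.map_append, List.foldl_append, ih]; rfl

/-- The auxiliary coefficients `A_{i-1}`. -/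
def Bc {R : Type*} [CommRing R] (w : ℕ → R) (c : R) : ℕ → R
  | 0 => 0
  | 1 => c
  | i + 2 => w (i + 1) + Bc w c i

lemma odd_ne (p k i : ℕ) [Fact p.Prime] (hk2 : 2 * k < p) (hi : i < 2 * k) :
    (2 * (k : ZMod p) - 2 * (i : ZMod p) - 1) ≠ 0 := by
  intro h
  have h2 : (((2 * (k : ℤ) - 2 * i - 1 : ℤ)) : ZMod p) = 0 := by push_cast; exact h
  rw [ZMod.intCast_zmod_eq_zero_iff_dvd] at h2
  have := Int.eq_zero_of_abs_lt_dvd h2 (by rw [abs_lt]; constructor <;> omega)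
  omega

lemma nat_ne_s6 (p i : ℕ) (h0 : 0 < i) (hi : i < p) : (i : ZMod p) ≠ 0 := by
  intro h
  rw [ZMod.natCast_eq_zero_iff] at h
  exact absurd (Nat.le_of_dvd h0 h) (by omega)

lemma Bc_props (p k : ℕ) [Fact p.Prime] (hk1 : 1 ≤ k) (hk2 : 2 * k < p) (w : ℕ → ZMod p)
    (c : ZMod p) (hw1 : w 1 * c = 2 * (k : ZMod p) - 1)
    (hwrec : ∀ i, 1 ≤ i → i ≤ 2 * k - 1 →
      w (i + 1) * w i * (i * (2 * (k : ZMod p) - i)) =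
        (2 * (k : ZMod p) - 2 * (i : ZMod p) - 1) * (2 * (k : ZMod p) - 2 * (i : ZMod p) + 1))
    (i : ℕ) (hi : i < 2 * k) :
    w (i + 1) * Bc w c (i + 1) = 2 * (k : ZMod p) - 2 * i - 1 ∧
      Bc w c (i + 1) * Bc w c i = i * (2 * (k : ZMod p) - i) := by
  induction i with
  | zero => simp [Bc, hw1]
  | succ i ih =>
    obtain ⟨h1, h2⟩ := ih (by omega)
    have h3 : Bc w c (i + 1 + 1) * Bc w c (i + 1)
        = ((i + 1 : ℕ) : ZMod p) * (2 * (k : ZMod p) - (i + 1 : ℕ)) := by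
      change (w (i + 1) + Bc w c i) * Bc w c (i + 1) = _
      push_cast
      linear_combination h1 + h2
    refine ⟨?_, h3⟩
    have h4 := hwrec (i + 1) (by omega) (by omega)
    have h5 := odd_ne p k i hk2 (by omega)
    apply mul_right_cancel₀ h5
    rw [← h3] at h4
    push_cast at h4 ⊢
    linear_combination h4 - w (i + 1 + 1) * Bc w c (i + 1 + 1) * h1

lemma Bc_last (p k : ℕ) [Fact p.Prime] (hk1 : 1 ≤ k) (hk2 : 2 * k < p) (w : ℕ → ZMod p)
    (c : ZMod p) (hw1 : w 1 * c = 2 * (k : ZMod p) - 1)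
    (hwrec : ∀ i, 1 ≤ i → i ≤ 2 * k - 1 →
      w (i + 1) * w i * (i * (2 * (k : ZMod p) - i)) =
        (2 * (k : ZMod p) - 2 * (i : ZMod p) - 1) * (2 * (k : ZMod p) - 2 * (i : ZMod p) + 1)) :
    Bc w c (2 * k + 1) = 0 := by
  obtain ⟨m, rfl⟩ : ∃ m, k = m + 1 := ⟨k - 1, by omega⟩
  obtain ⟨h1, h2⟩ := Bc_props p (m + 1) hk1 hk2 w c hw1 hwrec (2 * m + 1) (by omega)
  have h5 := odd_ne p (m + 1) (2 * m + 1) hk2 (by omega)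
  have h6 : Bc w c (2 * m + 1 + 1) ≠ 0 := by
    intro h; rw [h, mul_zero] at h1; exact h5 h1.symm
  apply (mul_eq_zero.mp _).resolve_right h6
  change (w (2 * m + 1 + 1) + Bc w c (2 * m + 1)) * Bc w c (2 * m + 1 + 1) = 0
  push_cast at h1 h2 ⊢
  linear_combination h1 + h2

section
variable {F : Type*} [Field F] (w : ℕ → F) (c : F) (k : ℕ)

lemma ode (hB : ∀ i, i < 2 * k → w (i + 1) * Bc w c (i + 1) = 2 * (k : F) - 2 * i - 1)
    (i : ℕ) (hi : i ≤ 2 * k) :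
    let q := stp (fun i => C (w (i + 1)) * X) (1, 0) i
    let r := stp (fun i => C (w (i + 1)) * X) (0, 1) i
    (X ^ 2 - 1) * derivative q.1 = (i : F[X]) * X * q.1 - C (Bc w c (i + 1)) * q.2 ∧
    (X ^ 2 - 1) * derivative q.2 = (2 * (k : F[X]) - (i : F[X])) * X * q.2 - C (Bc w c i) * q.1 ∧
    (X ^ 2 - 1) * derivative r.1 =
      C c * q.1 - (2 * (k : F[X]) - (i : F[X])) * X * r.1 - C (Bc w c (i + 1)) * r.2 ∧
    (X ^ 2 - 1) * derivative r.2 =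
      C c * q.2 - C (Bc w c i) * r.1 - (i : F[X]) * X * r.2 := by
  induction i with
  | zero => simp [stp, Bc]
  | succ i ih =>
    intro q r
    obtain ⟨h1, h2, h3, h4⟩ := ih (by omega)
    have hb := congrArg C (hB i (by omega))
    have e : Bc w c (i + 1 + 1) = w (i + 1) + Bc w c i := rfl
    simp only [C_mul, C_sub, map_natCast, map_ofNat, C_1] at hb
    simp only [q, r, stp, e, C_add, derivative_add, derivative_mul, derivative_C, derivative_X]
    push_cast
    set x := (stp (fun i => C (w (i + 1)) * X) (1, 0) i).1
    set y := (stp (fun i => C (w (i + 1)) * X) (1, 0) i).2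
    set u := (stp (fun i => C (w (i + 1)) * X) (0, 1) i).1
    set v := (stp (fun i => C (w (i + 1)) * X) (0, 1) i).2
    refine ⟨?_, ?_, ?_, ?_⟩
    · linear_combination C (w (i + 1)) * X * h1 + h2 - X * y * hb
    · linear_combination h1 + X * x * hb
    · linear_combination C (w (i + 1)) * X * h3 + h4 - X * v * hb
    · linear_combination h3 + X * u * hb

lemma stp_det (i : ℕ) :
    let q := stp (fun i => C (w (i + 1)) * X) (1, 0) i
    let r := stp (fun i => C (w (i + 1)) * X) (0, 1) i
    q.1 * r.2 - q.2 * r.1 = (-1) ^ i := by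
  induction i with
  | zero => simp [stp]
  | succ i ih =>
    simp only [stp, pow_succ] at ih ⊢
    linear_combination -ih

lemma stp_eval (s : F[X] × F[X]) (m : ℕ) :
    (stp (fun i => C (w (i + 1)) * X) s (2 * m)).1.eval 0 = s.1.eval 0 ∧
    (stp (fun i => C (w (i + 1)) * X) s (2 * m)).2.eval 0 = s.2.eval 0 := by
  induction m with
  | zero => simp [stp]
  | succ m ih =>
    rw [show 2 * (m + 1) = 2 * m + 1 + 1 by ring]
    simp only [stp, eval_add, eval_mul, eval_C, eval_X]
    simpa using ih

lemma stp_deg (s : F[X] × F[X]) (h1 : s.1.natDegree = 0) (h2 : s.2.natDegree = 0) (m : ℕ) :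
    (stp (fun i => C (w (i + 1)) * X) s m).1.natDegree ≤ m ∧
    (stp (fun i => C (w (i + 1)) * X) s m).2.natDegree ≤ m := by
  induction m with
  | zero => simp [stp, h1, h2]
  | succ m ih =>
    simp only [stp]
    refine ⟨?_, by omega⟩
    refine (natDegree_add_le _ _).trans (max_le ?_ (by omega))
    refine natDegree_mul_le.trans ?_
    have := (natDegree_C_mul_le (w (m + 1)) X).trans natDegree_X_le
    omega
end

lemma eq_of_deriv (p : ℕ) [Fact p.Prime] (f g : (ZMod p)[X]) (hf : f.natDegree < p)
    (hg : g.natDegree < p) (h0 : f.eval 0 = g.eval 0) (hd : derivative f = derivative g) :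
    f = g := by
  ext n
  rcases n with _ | n
  · simpa [coeff_zero_eq_eval_zero] using h0
  by_cases hn : n + 1 < p
  · have := congrArg (fun f => coeff f n) hd
    simp only [coeff_derivative] at this
    have h2 := nat_ne_s6 p (n + 1) (by omega) hn
    push_cast at h2
    exact mul_right_cancel₀ h2 this
  · rw [coeff_eq_zero_of_natDegree_lt (by omega), coeff_eq_zero_of_natDegree_lt (by omega)]

lemma ode_zero (p : ℕ) [Fact p.Prime] (d : ZMod p) (e : (ZMod p)[X]) (he : e.natDegree < p)
    (h0 : e.eval 0 = 0) (hd : (X ^ 2 - 1) * derivative e = C d * (X * e)) : e = 0 := by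
  have key : ∀ n, e.coeff n = 0 ∧ e.coeff (n + 1) = 0 := by
    intro n
    induction n with
    | zero =>
      refine ⟨by simpa [coeff_zero_eq_eval_zero] using h0, ?_⟩
      have := congrArg (fun f => coeff f 0) hd
      simpa [sub_mul, mul_coeff_zero, coeff_derivative] using this
    | succ n ih =>
      refine ⟨ih.2, ?_⟩
      by_cases hn : n + 1 + 1 < p
      · have := congrArg (fun f => coeff f (n + 1)) hd
        rw [sub_mul, one_mul] at this
        have h3 : (X ^ 2 * derivative e).coeff (n + 1) = 0 := by
          rw [pow_two, mul_assoc, coeff_X_mul]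
          rcases n with _ | n
          · simp
          · rw [coeff_X_mul, coeff_derivative, ih.1, zero_mul]
        simp only [coeff_sub, h3, coeff_C_mul, coeff_X_mul, ih.1, coeff_derivative] at this
        have h2 := nat_ne_s6 p (n + 1 + 1) (by omega) hn
        push_cast at h2
        have h4 : e.coeff (n + 1 + 1) * ((n : ZMod p) + 1 + 1) = 0 := by
          push_cast at this
          linear_combination -this
        exact (mul_eq_zero.mp h4).resolve_right h2
      · exact coeff_eq_zero_of_natDegree_lt (by omega)
  ext n
  simpa using (key n).1

/-- The constant `ω_k`. -/
def om (p k : ℕ) : ZMod p :=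
  (-1) ^ (k - 1) * ∏ i ∈ Finset.Icc 1 k, (1 - (2 * (i : ZMod p))⁻¹)

/-- Explicit form of `R_{k+1}`. -/
def Gk (p : ℕ) : ℕ → (ZMod p)[X]
  | 0 => X
  | k + 1 => Gk p k - C (om p (k + 1)) * X * (X ^ 2 - 1) ^ (k + 1)

lemma two_ne (p k : ℕ) [Fact p.Prime] (hk1 : 1 ≤ k) (hk2 : 2 * k < p) : (2 * (k : ZMod p)) ≠ 0 := by
  have := nat_ne_s6 p (2 * k) (by omega) hk2
  simpa using this

lemma om_one (p : ℕ) [Fact p.Prime] (h : 2 < p) : 2 * om p 1 = 1 := by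
  have h2 := two_ne p 1 le_rfl (by omega)
  simp only [Nat.cast_one, mul_one] at h2
  simp only [om, Finset.Icc_self, Finset.prod_singleton, Nat.cast_one]
  field_simp
  ring

lemma om_succ (p k : ℕ) [Fact p.Prime] (h : 2 * (k + 1 + 1) < p) :
    2 * ((k : ZMod p) + 1 + 1) * om p (k + 1 + 1) = -(2 * k + 3) * om p (k + 1) := by
  have h2 := two_ne p (k + 1 + 1) (by omega) h
  rw [om, om, Finset.prod_Icc_succ_top (by omega)]
  simp only [Nat.add_sub_cancel, pow_succ]
  push_cast at h2 ⊢
  have h3 : 2 * ((k : ZMod p) + 1 + 1) * (2 * ((k : ZMod p) + 1 + 1))⁻¹ = 1 := mul_inv_cancel₀ h2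
  generalize (2 * ((k : ZMod p) + 1 + 1))⁻¹ = z at *
  linear_combination (-1) ^ k * (∏ i ∈ Finset.Icc 1 (k + 1), (1 - (2 * (i : ZMod p))⁻¹)) * h3

lemma om_ne (p k : ℕ) [Fact p.Prime] (h : 2 * k < p) : om p k ≠ 0 := by
  rw [om]
  refine mul_ne_zero (pow_ne_zero _ (by simp)) ?_
  rw [Finset.prod_ne_zero_iff]
  intro i hi
  rw [Finset.mem_Icc] at hi
  have h2 := two_ne p i hi.1 (by omega)
  have h3 := nat_ne_s6 p (2 * i - 1) (by omega) (by omega)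
  rw [Nat.cast_sub (by omega)] at h3
  push_cast at h3
  intro h4
  apply h3
  have h5 := mul_inv_cancel₀ h2
  linear_combination h5 + 2 * (i : ZMod p) * h4

lemma Gk_props (p k : ℕ) [Fact p.Prime] (hodd : Odd p) (h : 2 * (k + 1) < p) :
    derivative (Gk p k) = C (2 * ((k : ZMod p) + 1) * om p (k + 1)) * (X ^ 2 - 1) ^ k ∧
    (Gk p k).eval 0 = 0 ∧ (Gk p k).eval 1 = 1 ∧ (Gk p k).natDegree ≤ 2 * k + 1 ∧
    ((X ^ 2 - 1) ^ (k + 1) ∣ X ^ p - Gk p k) := by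
  induction k with
  | zero =>
    refine ⟨?_, by simp [Gk], by simp [Gk], by simp [Gk], ?_⟩
    · have := om_one p (by omega)
      simp [Gk, this]
    · obtain ⟨m, rfl⟩ := hodd
      have : (X : (ZMod (2 * m + 1))[X]) ^ 2 - 1 ∣ (X ^ 2) ^ m - 1 ^ m := sub_dvd_pow_sub_pow _ _ _
      rw [zero_add, pow_one]
      refine (this.mul_right X).trans (dvd_of_eq ?_)
      simp only [Gk]
      ring
  | succ k ih =>
    obtain ⟨h1, h2, h3, h4, h5⟩ := ih (by omega)
    have ho := om_succ p k h
    refine ⟨?_, by simp [Gk, h2], by simp [Gk, h3], ?_, ?_⟩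
    · have hoC := congrArg C ho
      simp only [Gk, derivative_sub, h1, derivative_mul, derivative_pow, derivative_X, derivative_C,
        derivative_one, Nat.add_sub_cancel]
      simp only [C_mul, C_add, C_neg, map_natCast, map_ofNat, C_1, Nat.cast_add, Nat.cast_one,
        map_add, map_one, Nat.cast_ofNat] at hoC ⊢
      linear_combination -((X ^ 2 - 1) ^ (k + 1)) * hoC
    · simp only [Gk]
      refine (natDegree_sub_le _ _).trans (max_le (by omega) ?_)
      refine natDegree_mul_le.trans ?_
      have a := (natDegree_C_mul_le (om p (k + 1)) X).trans natDegree_X_le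
      have b : ((X : (ZMod p)[X]) ^ 2 - 1).natDegree ≤ 2 := by compute_degree
      have c := natDegree_pow_le_of_le (k + 1) b
      omega
    · obtain ⟨g, hg⟩ := h5
      have hd := congrArg derivative hg
      have hne : ((X : (ZMod p)[X]) ^ 2 - 1) ≠ 0 := by
        have := (monic_X_pow_sub_C (1 : ZMod p) (n := 2) (by norm_num)).ne_zero
        simpa using this
      have hk0 := two_ne p (k + 1) (by omega) (by omega)
      have hd2 : 2 * ((k : (ZMod p)[X]) + 1) * X * g + (X ^ 2 - 1) * derivative g
          = - C (2 * ((k : ZMod p) + 1) * om p (k + 1)) := by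
        apply mul_left_cancel₀ (pow_ne_zero k hne)
        simp only [derivative_sub, h1, derivative_mul, derivative_X_pow, derivative_pow,
          derivative_X, derivative_one, Nat.add_sub_cancel, CharP.cast_eq_zero, map_zero,
          map_natCast, map_ofNat, C_mul, C_add, C_1, Nat.cast_add, Nat.cast_one,
          map_add, map_one, Nat.cast_ofNat] at hd ⊢
        linear_combination -hd
      have hC : C (2 * ((k : ZMod p) + 1))⁻¹ * (2 * ((k : (ZMod p)[X]) + 1)) = 1 := by
        have : (2 * ((k : (ZMod p)[X]) + 1)) = C (2 * ((k : ZMod p) + 1)) := by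
          simp only [C_mul, C_add, C_1, map_natCast, map_ofNat]
        push_cast at hk0
        rw [this, ← C_mul, inv_mul_cancel₀ hk0, C_1]
      refine ⟨C (2 * ((k : ZMod p) + 1))⁻¹ * (-X * derivative g) - g, ?_⟩
      have e : X ^ p - Gk p (k + 1)
          = (X ^ 2 - 1) ^ (k + 1) * (g + C (om p (k + 1)) * X) := by
        simp only [Gk]
        linear_combination hg
      rw [e, pow_succ _ (k + 1), mul_assoc]
      congr 1
      simp only [C_mul, C_add, C_1, map_natCast, map_ofNat] at hd2 ⊢
      generalize C (2 * ((k : ZMod p) + 1))⁻¹ = z at *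
      linear_combination z * X * hd2 - (X ^ 2 * g + C (om p (k + 1)) * X) * hC

lemma Rk_eq_s6 (p k : ℕ) [Fact p.Prime] (hodd : Odd p) (h : 2 * (k + 1) < p) :
    Rk p (k + 1) = Gk p k := by
  obtain ⟨h1, h2, h3, h4, g, hg⟩ := Gk_props p k hodd h
  have hm2 : ((X : (ZMod p)[X]) ^ 2 - 1).Monic := by
    simpa using (monic_X_pow_sub_C (1 : ZMod p) (n := 2) (by norm_num))
  have hm := hm2.pow (k + 1)
  refine (div_modByMonic_unique g (Gk p k) hm ⟨by linear_combination -hg, ?_⟩).2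
  refine degree_lt_degree ?_
  have : ((X : (ZMod p)[X]) ^ 2 - 1).natDegree = 2 := by
    simpa using natDegree_X_pow_sub_C (n := 2) (r := (1 : ZMod p))
  rw [hm2.natDegree_pow, this]
  omega

theorem stmt_6 (p k : ℕ) [Fact (Nat.Prime p)] (hodd : Odd p)
    (hk1 : 1 ≤ k) (hk2 : 2 * k < p)
    (ω : ZMod p)
    (hω : ω = (-1) ^ (k - 1) * ∏ i ∈ Finset.Icc 1 k, (1 - (2 * (i : ZMod p))⁻¹))
    (w : ℕ → ZMod p)
    (hwne : ∀ i, 1 ≤ i → i ≤ 2 * k → w i ≠ 0)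
    (hw1 : w 1 = (2 * (k : ZMod p) - 1) * (2 * (k : ZMod p) * ω)⁻¹)
    (hwrec : ∀ i, 1 ≤ i → i ≤ 2 * k - 1 →
      w (i + 1) * w i =
        (2 * (k : ZMod p) - 2 * (i : ZMod p) - 1) * (2 * (k : ZMod p) - 2 * (i : ZMod p) + 1)
          * ((i : ZMod p) * (2 * (k : ZMod p) - (i : ZMod p)))⁻¹)
    (W : List (Polynomial (ZMod p)))
    (hW : W = (List.range (2 * k)).map fun i => C (w (i + 1)) * X) :
    cont W = (-1) ^ k * Pk p k ∧
    cont W.tail = (-1) ^ k * Rk p k ∧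
    cont W.dropLast = (-1) ^ (k + 1) * Rk p k := by
  obtain ⟨m, rfl⟩ : ∃ m, k = m + 1 := ⟨k - 1, by omega⟩
  change ω = om p (m + 1) at hω
  have hω0 : ω ≠ 0 := hω ▸ om_ne p (m + 1) hk2
  have hk0 := two_ne p (m + 1) hk1 hk2
  obtain ⟨g1, g2, g3, g4, -⟩ := Gk_props p m hodd hk2
  rw [Rk_eq_s6 p m hodd hk2]
  set c := 2 * ((m + 1 : ℕ) : ZMod p) * ω with hc
  have hc0 : c ≠ 0 := mul_ne_zero hk0 hω0
  have hw1' : w 1 * c = 2 * ((m + 1 : ℕ) : ZMod p) - 1 := by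
    rw [hw1, mul_assoc, inv_mul_cancel₀ hc0, mul_one]
  have hrec' : ∀ i, 1 ≤ i → i ≤ 2 * (m + 1) - 1 →
      w (i + 1) * w i * (i * (2 * ((m + 1 : ℕ) : ZMod p) - i)) =
        (2 * ((m + 1 : ℕ) : ZMod p) - 2 * (i : ZMod p) - 1)
          * (2 * ((m + 1 : ℕ) : ZMod p) - 2 * (i : ZMod p) + 1) := by
    intro i h1 h2
    have a1 := nat_ne_s6 p i h1 (by omega)
    have a2 := nat_ne_s6 p (2 * (m + 1) - i) (by omega) (by omega)
    rw [Nat.cast_sub (by omega), Nat.cast_mul, Nat.cast_ofNat] at a2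
    rw [hwrec i h1 h2, mul_assoc, inv_mul_cancel₀ (mul_ne_zero a1 a2), mul_one]
  have hB := fun i hi => (Bc_props p (m + 1) hk1 hk2 w c hw1' hrec' i hi).1
  have hBl := Bc_last p (m + 1) hk1 hk2 w c hw1' hrec'
  obtain ⟨o1, o2, o3, -⟩ := ode w c (m + 1) hB (2 * (m + 1)) le_rfl
  have hdet := stp_det w (2 * (m + 1))
  obtain ⟨e1, e2⟩ := stp_eval w (1, 0) (m + 1)
  obtain ⟨e3, -⟩ := stp_eval w (0, 1) (m + 1)
  obtain ⟨d1, d2⟩ := stp_deg w (1, 0) (by simp) (by simp) (2 * (m + 1))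
  obtain ⟨d3, -⟩ := stp_deg w (0, 1) (by simp) (by simp) (2 * (m + 1))
  have c1 : cont W = (stp (fun i => C (w (i + 1)) * X) (1, 0) (2 * (m + 1))).1 := by
    rw [hW, cont, foldl_stp]
  have c2 : cont W.tail = (stp (fun i => C (w (i + 1)) * X) (0, 1) (2 * (m + 1))).1 := by
    rw [← foldl_stp, ← hW]
    rcases W with _ | ⟨a, l⟩
    · have := congrArg List.length hW
      simp at this
    · simp [cont]
  have c3 : cont W.dropLast = (stp (fun i => C (w (i + 1)) * X) (1, 0) (2 * (m + 1))).2 := by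
    rw [hW, show 2 * (m + 1) = 2 * m + 1 + 1 by ring, List.range_succ, List.map_append,
      List.map_singleton, List.dropLast_concat, cont, foldl_stp]
    rfl
  rw [c1, c2, c3]
  set q := stp (fun i => C (w (i + 1)) * X) (1, 0) (2 * (m + 1))
  set r := stp (fun i => C (w (i + 1)) * X) (0, 1) (2 * (m + 1))
  simp only [hBl, C_0, zero_mul, sub_zero] at o1 o2 o3
  simp only [eval_one, eval_zero] at e1 e2 e3
  have hne : ((X : (ZMod p)[X]) ^ 2 - 1) ≠ 0 := by
    have := (monic_X_pow_sub_C (1 : ZMod p) (n := 2) (by norm_num)).ne_zero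
    simpa using this
  have hsq : ((-1 : (ZMod p)[X]) ^ m) * (-1) ^ m = 1 := by
    rw [← mul_pow]; simp
  have hsC : ((-1 : (ZMod p)[X]) ^ (m + 1)) = C ((-1) ^ (m + 1)) := by simp
  have hsC2 : ((-1 : (ZMod p)[X]) ^ (m + 1 + 1)) = C ((-1) ^ (m + 1 + 1)) := by simp
  have A1 : q.1 = (-1) ^ (m + 1) * Pk p (m + 1) := by
    rw [← sub_eq_zero]
    apply ode_zero p (2 * ((m + 1 : ℕ) : ZMod p))
    · have b : ((X : (ZMod p)[X]) ^ 2 - 1).natDegree ≤ 2 := by compute_degree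
      have b2 := natDegree_pow_le_of_le (m + 1) b
      refine lt_of_le_of_lt ((natDegree_sub_le _ _).trans (max_le d1 ?_)) hk2
      rw [hsC]
      refine (natDegree_C_mul_le _ _).trans ?_
      rw [Pk]; omega
    · rw [eval_sub, e1]
      simp only [Pk, eval_mul, eval_pow, eval_neg, eval_one, eval_sub, eval_X]
      rw [← mul_pow]; simp
    · rw [derivative_sub, mul_sub, o1, hsC, derivative_C_mul, Pk]
      simp only [derivative_pow, derivative_sub, derivative_X, derivative_one,
        Nat.add_sub_cancel, C_mul, map_natCast, map_ofNat]
      push_cast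
      ring
  have key : ∀ (s b : ZMod p) (f : (ZMod p)[X]), f.natDegree ≤ 2 * (m + 1) → f.eval 0 = 0 →
      (X ^ 2 - 1) * derivative f = C b * q.1 → b * (-1) ^ (m + 1) = s * c → f = C s * Gk p m := by
    intro s b f hf h0 hd hs
    apply eq_of_deriv p _ _ (by omega)
    · exact lt_of_le_of_lt (natDegree_C_mul_le _ _) (by omega)
    · rw [h0, eval_mul, g2, mul_zero]
    · apply mul_left_cancel₀ hne
      rw [hd, derivative_C_mul, g1, A1, Pk, hsC]
      have hs' := congrArg C hs
      rw [hc, hω] at hs'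
      simp only [C_mul] at hs' ⊢
      simp only [C_add, map_natCast, map_ofNat, C_1, Nat.cast_add, Nat.cast_one, map_add,
        map_one] at hs' ⊢
      linear_combination (X ^ 2 - 1) ^ (m + 1) * hs'
  have A2 : r.1 = (-1) ^ (m + 1) * Gk p m := by
    rw [hsC]
    refine key _ c _ d3 e3 ?_ (mul_comm _ _)
    rw [o3]; push_cast; ring
  refine ⟨A1, A2, ?_⟩
  have A3 := key (-Bc w c (2 * (m + 1)) * (-1) ^ (m + 1) / c) (-Bc w c (2 * (m + 1))) q.2 d2 e2
    (by rw [o2, C_neg]; push_cast; ring) (by field_simp)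
  generalize (-Bc w c (2 * (m + 1)) * (-1) ^ (m + 1) / c) = s at A3
  have hv := congrArg (eval 1) hdet
  rw [A1, A2, A3] at hv
  simp only [Pk, eval_mul, eval_pow, eval_neg, eval_one, eval_sub, eval_X, eval_C, g3] at hv
  have hs : s = (-1) ^ (m + 1 + 1) := by
    have h1 : ((-1 : ZMod p) ^ (m + 1)) * (-1) ^ (m + 1) = 1 := by
      rw [← mul_pow]; simp
    rw [pow_mul] at hv
    simp only [one_pow, sub_self, zero_pow (Nat.succ_ne_zero m), neg_one_sq] at hv
    rw [pow_succ]
    linear_combination -(-1) ^ (m + 1) * hv - s * h1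
  rw [A3, hsC2, hs]
end
end

section
/- Let k = (p−1)/2 and let ρ ∈ F(p) be the infinite continued fraction ρ = [−2T, 2T, −2T, 2T, ...] (with n-th partial quotient 2·(−1)^n·T). Then for every integer ℓ ≥ 1 we have ρ^p = (−1)^ℓ·P_k·ρ_{ℓ+1} − R_k, where ρ_{ℓ+1} is the (ℓ+1)-th complete quotient of ρ. -/
open Polynomial

noncomputable section

/-- Uniqueness of the expansion: consecutive complete quotients are opposite. -/
theorem step_neg {K : Type*} [Field K] (t : LaurentSeries K) (r : ℕ → LaurentSeries K)
    (hord : ∀ n, 1 ≤ n → (r n).order < 0)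
    (hcf : ∀ n, 1 ≤ n → r n = (-1) ^ n * t + (r (n + 1))⁻¹) :
    ∀ n, 1 ≤ n → r n + r (n + 1) = 0 := by
  have hne : ∀ n, 1 ≤ n → r n ≠ 0 := by
    intro n hn h0
    have := hord n hn
    simp [h0] at this
  have hinv : ∀ n, 1 ≤ n → 1 ≤ ((r n)⁻¹).order := by
    intro n hn
    have h1 := HahnSeries.order_mul (hne n hn) (inv_ne_zero (hne n hn))
    rw [mul_inv_cancel₀ (hne n hn), HahnSeries.order_one] at h1
    have := hord n hn
    omega
  have hd : ∀ n, 1 ≤ n → r n + r (n + 1) = (r (n + 1))⁻¹ + (r (n + 1 + 1))⁻¹ := by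
    intro n hn
    have h1 := hcf n hn
    have h2 := hcf (n + 1) (by omega)
    rw [pow_succ] at h2
    linear_combination h1 + h2
  have hrec : ∀ n, 1 ≤ n → r n + r (n + 1) =
      (r (n + 1) + r (n + 1 + 1)) * ((r (n + 1))⁻¹ * (r (n + 1 + 1))⁻¹) := by
    intro n hn
    rw [hd n hn]
    have h1 := hne (n + 1) (by omega)
    have h2 := hne (n + 1 + 1) (by omega)
    field_simp
    ring
  have key : ∀ N : ℕ, ∀ n, 1 ≤ n → r n + r (n + 1) ≠ 0 → (N : ℤ) ≤ (r n + r (n + 1)).order := by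
    intro N
    induction N with
    | zero =>
      intro n hn h0
      rw [hd n hn] at h0 ⊢
      have h1 := HahnSeries.min_order_le_order_add h0
      have h2 := hinv (n + 1) (by omega)
      have h3 := hinv (n + 1 + 1) (by omega)
      have h4 := (le_min h2 h3).trans h1
      push_cast
      omega
    | succ N ih =>
      intro n hn h0
      rw [hrec n hn] at h0 ⊢
      have h1 := left_ne_zero_of_mul h0
      have h2 := right_ne_zero_of_mul h0
      rw [HahnSeries.order_mul h1 h2,
        HahnSeries.order_mul (left_ne_zero_of_mul h2) (right_ne_zero_of_mul h2)]
      have h3 := hinv (n + 1) (by omega)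
      have h4 := hinv (n + 1 + 1) (by omega)
      have h5 := ih (n + 1) (by omega) h1
      push_cast
      omega
  intro n hn
  by_contra h0
  have := key ((r n + r (n + 1)).order.toNat + 1) n hn h0
  push_cast at this
  omega

theorem Pk_monic (p k : ℕ) [Fact (Nat.Prime p)] : (Pk p k).Monic := by
  unfold Pk
  exact (monic_X_pow_sub_C (1 : ZMod p) two_ne_zero).pow k

theorem Pk_natDegree (p k : ℕ) [Fact (Nat.Prime p)] : (Pk p k).natDegree = 2 * k := by
  unfold Pk
  have : (X ^ 2 - 1 : Polynomial (ZMod p)).natDegree = 2 := natDegree_X_pow_sub_C (r := (1 : ZMod p))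
  rw [natDegree_pow, this, mul_comm]

theorem pow_sub_degree {K : Type*} [Field K] (k : ℕ) (hk : 1 ≤ k) :
    ((X : K[X]) ^ (2 * k + 1) - X * (X ^ 2 - 1) ^ k).degree < ((2 * k : ℕ) : WithBot ℕ) := by
  induction k, hk using Nat.le_induction with
  | base =>
    have : (X : K[X]) ^ (2 * 1 + 1) - X * (X ^ 2 - 1) ^ 1 = X := by ring
    rw [this, degree_X]
    norm_num
  | succ k hk ih =>
    have : (X : K[X]) ^ (2 * (k + 1) + 1) - X * (X ^ 2 - 1) ^ (k + 1)
      = (X ^ (2 * k + 1) - X * (X ^ 2 - 1) ^ k) * (X ^ 2 - C 1) + X ^ (2 * k + 1) := by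
      rw [map_one]; ring
    rw [this]
    refine (degree_add_le _ _).trans_lt (max_lt ?_ ?_)
    · rw [degree_mul, degree_X_pow_sub_C two_pos]
      have h : ((2 * (k + 1) : ℕ) : WithBot ℕ) = ((2 * k : ℕ) : WithBot ℕ) + ((2 : ℕ) : WithBot ℕ) := by
        norm_cast
      rw [h]
      exact WithBot.add_lt_add_right (by simp) ih
    · rw [degree_X_pow]
      norm_cast
      omega

theorem Rk_eq_s10 (p k : ℕ) [Fact (Nat.Prime p)] (hk1 : 1 ≤ k) (hpk : p = 2 * k + 1) :
    Rk p k = X ^ p - X * Pk p k := by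
  unfold Rk
  refine (div_modByMonic_unique X _ (Pk_monic p k) ⟨by ring, ?_⟩).2
  rw [degree_eq_natDegree (Pk_monic p k).ne_zero, Pk_natDegree]
  have := pow_sub_degree (K := ZMod p) k hk1
  rw [← hpk] at this
  exact this

theorem stmt_10 (p k : ℕ) [Fact (Nat.Prime p)] (hodd : Odd p)
    (hk1 : 1 ≤ k) (hpk : p = 2 * k + 1)
    -- `ρ = [-2T, 2T, -2T, 2T, …]`, with complete quotients `ρs n` (`ρ = ρs 1`)
    (ρ : LaurentSeries (ZMod p)) (ρs : ℕ → LaurentSeries (ZMod p)) (hρ1 : ρs 1 = ρ)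
    (hord : ∀ n, 1 ≤ n → (ρs n).order < 0)
    (hcf : ∀ n, 1 ≤ n →
      ρs n = aeval (Tinv (ZMod p)) (C (2 * (-1 : ZMod p) ^ n) * X) + (ρs (n + 1))⁻¹) :
    ∀ ℓ : ℕ, 1 ≤ ℓ →
      ρ ^ p = (-1) ^ ℓ * aeval (Tinv (ZMod p)) (Pk p k) * ρs (ℓ + 1)
        - aeval (Tinv (ZMod p)) (Rk p k) := by
  have hneg := step_neg (2 * Tinv (ZMod p)) ρs hord (by
    intro n hn
    rw [hcf n hn]
    simp only [map_mul, aeval_X, map_pow, map_neg, map_one, map_ofNat]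
    ring)
  have hl : ∀ n : ℕ, ρs (n + 1) = (-1) ^ n * ρ := by
    intro n
    induction n with
    | zero => simp [hρ1]
    | succ n ih =>
      have := hneg (n + 1) (by omega)
      rw [pow_succ]
      linear_combination this - ih
  have hρ0 : ρ ≠ 0 := by
    intro h0
    have := hord 1 le_rfl
    simp [hρ1, h0] at this
  have hquad : (ρ + Tinv (ZMod p)) ^ 2 = Tinv (ZMod p) ^ 2 - 1 := by
    have h1 := hcf 1 le_rfl
    rw [hl 1, hρ1] at h1
    simp only [map_mul, aeval_X, map_pow, map_neg, map_one, map_ofNat, pow_one, neg_mul, one_mul,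
      inv_neg] at h1
    have h2 : ρ * ρ⁻¹ = 1 := mul_inv_cancel₀ hρ0
    linear_combination ρ * h1 - h2
  haveI : CharP (LaurentSeries (ZMod p)) p :=
    charP_of_injective_algebraMap (algebraMap (ZMod p) (LaurentSeries (ZMod p))).injective p
  have hfrob : ρ ^ p + Tinv (ZMod p) ^ p
      = (ρ + Tinv (ZMod p)) * (Tinv (ZMod p) ^ 2 - 1) ^ k := by
    rw [← add_pow_char, ← hquad, ← pow_mul, ← pow_succ', ← hpk]
  intro ℓ _
  have hs : ((-1 : LaurentSeries (ZMod p)) ^ ℓ) * (-1) ^ ℓ = 1 := by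
    rw [← mul_pow]; simp
  rw [hl ℓ, Rk_eq_s10 p k hk1 hpk]
  simp only [Pk, map_mul, aeval_X, map_pow, map_sub, map_one]
  linear_combination hfrob - (Tinv (ZMod p) ^ 2 - 1) ^ k * ρ * hs
end
end

section
/- The continuants K_{n,m} = ⟨w_nT, ..., w_mT⟩ satisfy the symmetry relation K_{n,m} = (−1)^{m−n+1}·K_{2k+1−m, 2k+1−n} in F_p[T], for all 1 ≤ n ≤ m ≤ 2k. -/
open Polynomial

noncomputable section

def cstep {R : Type*} [CommRing R] (q : R × R) (a : R) : R × R := (a * q.1 + q.2, q.1)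

theorem cfold_lin {R : Type*} [CommRing R] (l : List R) : ∀ x y : R,
    (l.foldl cstep (x, y)).1 = x * (l.foldl cstep (1, 0)).1 + y * (l.foldl cstep (0, 1)).1 := by
  induction l with
  | nil => intro x y; simp
  | cons a t ih =>
    intro x y
    simp only [List.foldl_cons, cstep]
    rw [ih (a * x + y) x, ih (a * 1 + 0) 1, ih (a * 0 + 1) 0]
    ring

theorem cfold_reverse {R : Type*} [CommRing R] (l : List R) :
    l.reverse.foldl cstep (1, 0) = ((l.foldl cstep (1, 0)).1, (l.foldl cstep (0, 1)).1) := by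
  induction l with
  | nil => simp
  | cons a t ih =>
    rw [List.reverse_cons, List.foldl_append, ih]
    simp only [List.foldl_cons, List.foldl_nil, cstep]
    rw [cfold_lin t (a * 1 + 0) 1, cfold_lin t (a * 0 + 1) 0]
    ext <;> simp

theorem cfold_neg {R : Type*} [CommRing R] (l : List R) :
    (l.map (fun a => -a)).foldl cstep (1, 0) =
      ((-1) ^ l.length * (l.foldl cstep (1, 0)).1,
        (-1) ^ (l.length + 1) * (l.foldl cstep (1, 0)).2) := by
  induction l using List.reverseRecOn with
  | nil => simp
  | append_singleton l a ih =>
    rw [List.map_append, List.foldl_append, ih, List.foldl_append]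
    simp only [List.map_cons, List.map_nil, List.foldl_cons, List.foldl_nil, cstep,
      List.length_append, List.length_singleton]
    ext <;> ring

theorem cont_eq {R : Type*} [CommRing R] (l : List R) :
    cont l = (l.foldl cstep (1, 0)).1 := rfl

theorem cont_reverse {R : Type*} [CommRing R] (l : List R) : cont l.reverse = cont l := by
  rw [cont_eq, cfold_reverse, cont_eq]

theorem cont_neg {R : Type*} [CommRing R] (l : List R) :
    cont (l.map (fun a => -a)) = (-1) ^ l.length * cont l := by
  rw [cont_eq, cfold_neg, cont_eq]

/-- closed form of the coefficients -/
theorem w_closed {F : Type*} [Field F] (k : ℕ) (s : F) (hs : s * s = 1) (a w : ℕ → F)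
    (hne : ∀ i : ℕ, 1 ≤ i → i ≤ 2 * k → (i : F) ≠ 0)
    (ha0 : a 0 = 1)
    (ha : ∀ i, i < k → a (i + 1) * (2 * (i : F) + 2) = a i * (2 * (i : F) + 1))
    (hane : ∀ i, i ≤ k → a i ≠ 0)
    (hwne : ∀ i, 1 ≤ i → i ≤ 2 * k → w i ≠ 0)
    (hw1 : w 1 * (a k * (2 * (k : F))) = s * (2 * (k : F) - 1))
    (hwrec : ∀ i, 1 ≤ i → i ≤ 2 * k - 1 →
      w (i + 1) * w i * ((i : F) * (2 * (k : F) - (i : F))) =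
        (2 * (k : F) - 2 * (i : F) - 1) * (2 * (k : F) - 2 * (i : F) + 1)) :
    ∀ j m, j + m + 1 = k →
      w (2 * j + 1) * (a (m + 1) * (2 * (m : F) + 2)) = s * (2 * (m : F) + 1 - 2 * j) * a j ∧
      w (2 * j + 2) * (a (j + 1) * (2 * (j : F) + 2)) = s * (2 * (m : F) - 1 - 2 * j) * a m := by
  have step : ∀ j m, j + m + 1 = k →
      w (2 * j + 1) * (a (m + 1) * (2 * (m : F) + 2)) = s * (2 * (m : F) + 1 - 2 * j) * a j →
      w (2 * j + 2) * (a (j + 1) * (2 * (j : F) + 2)) = s * (2 * (m : F) - 1 - 2 * j) * a m := by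
    intro j m hjm h
    have hr := hwrec (2 * j + 1) (by omega) (by omega)
    have hn := hwne (2 * j + 1) (by omega) (by omega)
    have h1 := ha j (by omega)
    have h2 := ha m (by omega)
    have h3 := hane j (by omega)
    have h4 := hne (2 * m + 1) (by omega) (by omega)
    have h5 := hne (2 * j + 1) (by omega) (by omega)
    subst hjm
    push_cast at *
    rw [h1]
    rw [h2] at h
    have h6 : s ≠ 0 := by rintro rfl; simp at hs
    have hx : (2 * (m : F) + 1 - 2 * j) ≠ 0 := by
      intro h0
      rw [h0] at h
      have := hane m (by omega)
      simp_all
    apply mul_right_cancel₀ (mul_ne_zero (mul_ne_zero h6 hx) h4)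
    have hr' : w (2 * j + 2) * w (2 * j + 1) * ((2 * (j : F) + 1) * (2 * m + 1)) =
       (2 * (m : F) - 1 - 2 * j) * (2 * (m : F) + 1 - 2 * j) := by
      linear_combination hr
    linear_combination (-w (2 * j + 2) * (2 * (j : F) + 1) * (2 * m + 1)) * h + a m * (2 * m + 1) * hr' - (2 * (m : F) - 1 - 2 * j) * (2 * (m : F) + 1 - 2 * j) * a m * (2 * m + 1) * hs
  intro j
  induction j with
  | zero =>
    intro m hm
    have h1 : w (2 * 0 + 1) * (a (m + 1) * (2 * (m : F) + 2)) =
        s * (2 * (m : F) + 1 - 2 * (0 : ℕ)) * a 0 := by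
      subst hm
      rw [ha0]
      simp only [zero_add, mul_zero] at hw1 ⊢
      push_cast at hw1 ⊢
      linear_combination hw1
    exact ⟨h1, step 0 m hm h1⟩
  | succ j ih =>
    intro m hm
    obtain ⟨-, h⟩ := ih (m + 1) (by omega)
    have h1 : w (2 * (j + 1) + 1) * (a (m + 1) * (2 * (m : F) + 2)) =
        s * (2 * (m : F) + 1 - 2 * ((j + 1 : ℕ) : F)) * a (j + 1) := by
      have hr := hwrec (2 * j + 2) (by omega) (by omega)
      have hn := hwne (2 * j + 2) (by omega) (by omega)
      have h3 := hane (m + 1) (by omega)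
      have h6 : s ≠ 0 := by rintro rfl; simp at hs
      have h5 := hne (2 * j + 2) (by omega) (by omega)
      have h7 := hane (j + 1) (by omega)
      subst hm
      push_cast at *
      have hx : (2 * ((m : F) + 1) - 1 - 2 * j) ≠ 0 := by
        intro h0
        rw [h0] at h
        simp_all
      apply mul_right_cancel₀ (mul_ne_zero h6 hx)
      have hr' : w (2 * j + 3) * w (2 * j + 2) * ((2 * (j : F) + 2) * (2 * m + 2)) =
        (2 * (m : F) - 1 - 2 * j) * (2 * (m : F) + 1 - 2 * j) := by
        linear_combination hr
      have e : 2 * (j + 1) + 1 = 2 * j + 3 := by ring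
      rw [e]
      linear_combination (-w (2 * j + 3) * (2 * (m : F) + 2)) * h + a (j + 1) * hr' - (2 * (m : F) - 1 - 2 * j) * (2 * (m : F) + 1 - 2 * j) * a (j + 1) * hs
    exact ⟨h1, step (j + 1) m hm h1⟩

theorem stmt_12 (p k : ℕ) [Fact (Nat.Prime p)] (hodd : Odd p)
    (hk1 : 1 ≤ k) (hk2 : 2 * k < p)
    (ω : ZMod p)
    (hω : ω = (-1) ^ (k - 1) * ∏ i ∈ Finset.Icc 1 k, (1 - (2 * (i : ZMod p))⁻¹))
    (w : ℕ → ZMod p)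
    (hwne : ∀ i, 1 ≤ i → i ≤ 2 * k → w i ≠ 0)
    (hw1 : w 1 = (2 * (k : ZMod p) - 1) * (2 * (k : ZMod p) * ω)⁻¹)
    (hwrec : ∀ i, 1 ≤ i → i ≤ 2 * k - 1 →
      w (i + 1) * w i =
        (2 * (k : ZMod p) - 2 * (i : ZMod p) - 1) * (2 * (k : ZMod p) - 2 * (i : ZMod p) + 1)
          * ((i : ZMod p) * (2 * (k : ZMod p) - (i : ZMod p)))⁻¹)
    -- the continuants `K_{n,m} = ⟨w_n T, …, w_m T⟩`
    (K : ℕ → ℕ → Polynomial (ZMod p))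
    (hK : ∀ n m, K n m = cont ((List.range (m + 1 - n)).map fun i => C (w (n + i)) * X)) :
    ∀ n m, 1 ≤ n → n ≤ m → m ≤ 2 * k →
      K n m = (-1) ^ (m - n + 1) * K (2 * k + 1 - m) (2 * k + 1 - n) := by
  have hne : ∀ i : ℕ, 1 ≤ i → i ≤ 2 * k → (i : ZMod p) ≠ 0 := by
    intro i h1 h2 h
    rw [ZMod.natCast_eq_zero_iff] at h
    have := Nat.le_of_dvd h1 h
    omega
  set a : ℕ → ZMod p := fun n => ∏ i ∈ Finset.Icc 1 n, (1 - (2 * (i : ZMod p))⁻¹) with hadef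
  have ha0 : a 0 = 1 := by simp [hadef]
  have ha : ∀ i, i < k → a (i + 1) * (2 * (i : ZMod p) + 2) = a i * (2 * (i : ZMod p) + 1) := by
    intro i hi
    have h := hne (2 * (i + 1)) (by omega) (by omega)
    simp only [hadef]
    rw [Finset.prod_Icc_succ_top (by omega)]
    push_cast at h ⊢
    have h' : (1 - (2 * ((i : ZMod p) + 1))⁻¹) * (2 * (i : ZMod p) + 2) = 2 * (i : ZMod p) + 1 := by
      have := inv_mul_cancel₀ h
      linear_combination -this
    rw [mul_assoc, h']
  have hane : ∀ i, i ≤ k → a i ≠ 0 := by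
    intro i
    induction i with
    | zero => intro _; rw [ha0]; exact one_ne_zero
    | succ i ih =>
      intro hi h0
      have h := ha i (by omega)
      have h2 := hne (2 * i + 1) (by omega) (by omega)
      push_cast at h2
      rw [h0, zero_mul] at h
      exact mul_ne_zero (ih (by omega)) h2 h.symm
  have hs : ((-1 : ZMod p) ^ (k - 1)) * (-1) ^ (k - 1) = 1 := by
    rw [← mul_pow]; simp
  have hk0 : 2 * (k : ZMod p) ≠ 0 := by
    have := hne (2 * k) (by omega) le_rfl
    push_cast at this
    exact this
  have hω' : ω = (-1) ^ (k - 1) * a k := hω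
  have hω0 : ω ≠ 0 := by
    rw [hω']
    exact mul_ne_zero (left_ne_zero_of_mul_eq_one hs) (hane k le_rfl)
  have hcl := w_closed k ((-1 : ZMod p) ^ (k - 1)) hs a w hne ha0 ha hane hwne
    (by
      have h1 : w 1 * (2 * (k : ZMod p) * ω) = 2 * k - 1 := by
        rw [hw1, mul_assoc, inv_mul_cancel₀ (mul_ne_zero hk0 hω0), mul_one]
      rw [← h1, hω']
      linear_combination (-w 1 * 2 * k * a k) * hs)
    (by
      intro i h1 h2
      have e1 := hne i h1 (by omega)
      have e2 := hne (2 * k - i) (by omega) (by omega)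
      rw [Nat.cast_sub (by omega)] at e2
      push_cast at e2
      rw [hwrec i h1 h2, mul_assoc, inv_mul_cancel₀ (mul_ne_zero e1 e2), mul_one])
  have hodd' : ∀ j m, j + m + 1 = k → w (2 * m + 2) = - w (2 * j + 1) := by
    intro j m hjm
    have h1 := (hcl j m hjm).1
    have h2 := (hcl m j (by omega)).2
    have h3 := hne (2 * (m + 1)) (by omega) (by omega)
    have h4 := hane (m + 1) (by omega)
    push_cast at h3
    apply mul_right_cancel₀ (mul_ne_zero h4 h3)
    linear_combination h1 + h2
  have hanti : ∀ i, 1 ≤ i → i ≤ 2 * k → w i = - w (2 * k + 1 - i) := by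
    intro i h1 h2
    rcases Nat.even_or_odd' i with ⟨c, hc | hc⟩
    · have h := hodd' (k - c) (c - 1) (by omega)
      rw [show 2 * (c - 1) + 2 = i by omega, show 2 * (k - c) + 1 = 2 * k + 1 - i by omega] at h
      exact h
    · have h := hodd' c (k - c - 1) (by omega)
      rw [show 2 * (k - c - 1) + 2 = 2 * k + 1 - i by omega, show 2 * c + 1 = i by omega] at h
      rw [h, neg_neg]
  intro n m hn hnm hm
  rw [hK, hK]
  have hl : (List.range (m + 1 - n)).map (fun i => C (w (n + i)) * X) =
      (((List.range (2 * k + 1 - n + 1 - (2 * k + 1 - m))).map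
        fun i => C (w (2 * k + 1 - m + i)) * X).map (fun a => -a)).reverse := by
    apply List.ext_getElem
    · simp; omega
    · intro i h1 h2
      simp at h1
      simp only [List.getElem_map, List.getElem_range, List.getElem_reverse, List.length_map,
        List.length_range]
      rw [hanti (n + i) (by omega) (by omega)]
      rw [show 2 * k + 1 - m + (2 * k + 1 - n + 1 - (2 * k + 1 - m) - 1 - i) =
        2 * k + 1 - (n + i) by omega]
      simp
  rw [hl, cont_reverse, cont_neg]
  congr 2
  simp
  omega
end
end

section
/- Let V = [p, k, j, ε] with 1 ≤ j ≤ 2k−1 and ε ∈ F_p^*. Let α ∈ F(p) be the unique infinite continued fraction satisfying α = [w_{j+1}T, w_{j+2}T, ..., w_{2k}T, α_{2k−j+1}] and α^p = ε·(−1)^{k+j}·(P_k·α_{2k−j+1} − R_k). Then H(V)(α) = 0. -/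
open Polynomial

noncomputable section

theorem cont_foldl_lin {R : Type*} [CommRing R] (l : List R) : ∀ s t : R,
    (l.foldl (fun q a => (a * q.1 + q.2, q.1)) (s, t)).1
      = s * (l.foldl (fun q a => (a * q.1 + q.2, q.1)) ((1 : R), (0 : R))).1
        + t * (l.foldl (fun q a => (a * q.1 + q.2, q.1)) ((0 : R), (1 : R))).1 := by
  induction l with
  | nil => intro s t; simp
  | cons a l ih =>
    intro s t
    simp only [List.foldl_cons]
    rw [ih (a * s + t) s, ih (a * 1 + 0) 1, ih (a * 0 + 1) 0]
    ring

theorem cont_cons_cons {R : Type*} [CommRing R] (a b : R) (l : List R) :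
    cont (a :: b :: l) = a * cont (b :: l) + cont l := by
  unfold cont
  rw [List.foldl_cons, cont_foldl_lin, List.foldl_cons (l := l) (a := b) (b := ((0 : R), (1 : R)))]
  simp

theorem cont_left {R : Type*} [CommRing R] (f : ℕ → R) (n M : ℕ) :
    cont ((List.range (M + 2)).map fun i => f (n + i))
      = f n * cont ((List.range (M + 1)).map fun i => f (n + 1 + i))
        + cont ((List.range M).map fun i => f (n + 2 + i)) := by
  rw [List.range_succ_eq_map, List.range_succ_eq_map]
  simp only [List.map_cons, List.map_map]
  rw [cont_cons_cons]
  congr 1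
  · congr 2
    refine congrArg₂ _ rfl (List.map_congr_left fun i _ => ?_)
    simp only [Function.comp]
    congr 1
    omega
  · congr 1
    refine List.map_congr_left fun i _ => ?_
    simp only [Function.comp]
    congr 1
    omega

theorem cont_right {R : Type*} [CommRing R] (f : ℕ → R) (n : ℕ) :
    cont ((List.range (n + 2)).map f)
      = f (n + 1) * cont ((List.range (n + 1)).map f) + cont ((List.range n).map f) := by
  simp [cont, List.range_succ, List.foldl_append]

theorem ode_pair {F : Type*} [Field F] (k : ℕ) (w : ℕ → F) (y : ℕ → F[X])
    (hwne : ∀ i, 1 ≤ i → i ≤ 2 * k → w i ≠ 0)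
    (hne : ∀ m, m + 1 ≤ 2 * k → (2 * (m : F) + 1 - 2 * k) ≠ 0)
    (hrec : ∀ m, m + 2 ≤ 2 * k → w (m + 2) * w (m + 1) * ((m + 1) * (2 * k - m - 1))
      = (2 * k - 2 * m - 3) * (2 * k - 2 * m - 1))
    (y0 : y 0 = 1) (y1 : y 1 = C (w 1) * X)
    (yr : ∀ n, y (n + 2) = C (w (n + 2)) * X * y (n + 1) + y n) :
    ∀ m, m + 1 ≤ 2 * k →
      (C (w (m + 1)) * ((X ^ 2 - 1) * derivative (y m))
        = C (w (m + 1)) * ((2 * (k : F[X]) - (m : F[X]) - 1) * X * y m)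
          + (2 * (m : F[X]) + 1 - 2 * (k : F[X])) * y (m + 1)) ∧
      ((2 * (m : F[X]) + 1 - 2 * (k : F[X]))
          * ((X ^ 2 - 1) * derivative (y (m + 1)) - ((m : F[X]) + 1) * X * y (m + 1))
        = C (w (m + 1)) * (((m : F[X]) + 1) * (2 * (k : F[X]) - (m : F[X]) - 1)) * y m) := by
  intro m
  induction m with
  | zero =>
    intro _
    simp [y0, y1]
    constructor <;> ring
  | succ m ih =>
    intro hm
    obtain ⟨hA, hB⟩ := ih (by omega)
    have hr : C (w (m + 2)) * C (w (m + 1)) * (((m : F[X]) + 1) * (2 * k - m - 1))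
        = (2 * k - 2 * m - 3) * (2 * k - 2 * m - 1) := by
      have := congrArg (C : F → F[X]) (hrec m hm)
      simpa only [map_mul, map_add, map_sub, map_natCast, map_one, map_ofNat] using this
    have hne' : (2 * (m : F[X]) + 1 - 2 * k) ≠ 0 := by
      have := (C_ne_zero (R := F)).mpr (hne m (by omega))
      simpa only [map_mul, map_add, map_sub, map_natCast, map_one, map_ofNat] using this
    have hw1 : C (w (m + 1)) ≠ 0 := C_ne_zero.mpr (hwne _ (by omega) (by omega))
    have hA2 : C (w (m + 2)) * ((X ^ 2 - 1) * derivative (y (m + 1)))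
        = C (w (m + 2)) * ((2 * (k : F[X]) - ((m : F[X]) + 1) - 1) * X * y (m + 1))
          + (2 * ((m : F[X]) + 1) + 1 - 2 * (k : F[X])) * y (m + 2) := by
      apply mul_left_cancel₀ hne'
      rw [yr m]
      linear_combination C (w (m + 2)) * hB + y m * hr
    have hd : derivative (y (m + 2)) = C (w (m + 2)) * y (m + 1)
        + C (w (m + 2)) * X * derivative (y (m + 1)) + derivative (y m) := by
      rw [yr m]; simp
    push_cast
    refine ⟨hA2, ?_⟩
    apply mul_left_cancel₀ hw1
    rw [show m + 1 + 1 = m + 2 from rfl, hd]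
    have e := yr m
    linear_combination (2 * (m : F[X]) + 3 - 2 * k) * hA
      + (2 * (m : F[X]) + 3 - 2 * k) * C (w (m + 1)) * X * hA2
      - y (m + 1) * hr - (2 * (m : F[X]) + 3 - 2 * k) * C (w (m + 1)) * (2 * k - m - 1) * X * e

theorem const_of_deriv {p : ℕ} [Fact p.Prime] (f : (ZMod p)[X]) (hd : f.natDegree < p)
    (h : derivative f = 0) : f = C (f.coeff 0) := by
  ext n
  rcases n with _ | n
  · simp
  · rw [coeff_C_succ]
    by_cases hn : n + 1 < p
    · have := congrArg (fun g => g.coeff n) h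
      simp only [coeff_derivative, coeff_zero, mul_eq_zero] at this
      rcases this with h | h
      · exact h
      · exfalso
        have h' : ((n + 1 : ℕ) : ZMod p) = 0 := by push_cast; exact h
        rw [ZMod.natCast_eq_zero_iff] at h'
        exact absurd (Nat.le_of_dvd (by omega) h') (by omega)
    · exact coeff_eq_zero_of_natDegree_lt (by omega)

theorem zero_of_ode {p : ℕ} [Fact p.Prime] (k : ℕ) (f : (ZMod p)[X]) (hd : f.natDegree < p)
    (h0 : f.coeff 0 = 0) (h : (X ^ 2 - 1) * derivative f = 2 * (k : (ZMod p)[X]) * X * f) : f = 0 := by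
  have hne : ∀ n, n + 1 < p → ((n : ZMod p) + 1) ≠ 0 := by
    intro n hn h
    have h' : ((n + 1 : ℕ) : ZMod p) = 0 := by push_cast; exact h
    rw [ZMod.natCast_eq_zero_iff] at h'
    exact absurd (Nat.le_of_dvd (by omega) h') (by omega)
  have h1 : derivative f = X * (X * derivative f - C (2 * (k : ZMod p)) * f) := by
    simp only [map_mul, map_natCast, map_ofNat]
    linear_combination -h
  have key : ∀ n, f.coeff n = 0 := by
    intro n
    induction n using Nat.strong_induction_on with
    | _ n ih =>
      rcases n with _ | n
      · exact h0
      · by_cases hn : n + 1 < p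
        · have := congrArg (fun g => g.coeff n) h1
          simp only [coeff_derivative] at this
          have h2 : (X * (X * derivative f - C (2 * (k : ZMod p)) * f)).coeff n = 0 := by
            rcases n with _ | n
            · simp
            · rw [coeff_X_mul, coeff_sub, coeff_C_mul, ih n (by omega)]
              rcases n with _ | n
              · simp
              · rw [coeff_X_mul, coeff_derivative, ih (n + 1) (by omega)]; simp
          rw [h2] at this
          exact (mul_eq_zero.mp this).resolve_right (hne n hn)
        · exact coeff_eq_zero_of_natDegree_lt (by omega)
  ext n; simp [key n]

theorem y_natDegree {F : Type*} [Field F] (w : ℕ → F) (y : ℕ → F[X])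
    (y0 : y 0 = 1) (y1 : y 1 = C (w 1) * X)
    (yr : ∀ n, y (n + 2) = C (w (n + 2)) * X * y (n + 1) + y n) (n : ℕ) :
    (y n).natDegree ≤ n := by
  induction n using Nat.twoStepInduction with
  | zero => simp [y0]
  | one => rw [y1]; exact (natDegree_C_mul_le _ _).trans natDegree_X_le
  | more n h1 h2 =>
    rw [yr]
    refine (natDegree_add_le _ _).trans (max_le ?_ (by omega))
    refine natDegree_mul_le.trans ?_
    have := (natDegree_C_mul_le (w (n + 2)) X).trans natDegree_X_le
    omega

theorem y_parity {F : Type*} [Field F] (w : ℕ → F) (y : ℕ → F[X])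
    (y0 : y 0 = 1) (y1 : y 1 = C (w 1) * X)
    (yr : ∀ n, y (n + 2) = C (w (n + 2)) * X * y (n + 1) + y n) (n : ℕ) :
    (y n).eval (-1) = (-1) ^ n * (y n).eval 1 := by
  induction n using Nat.twoStepInduction with
  | zero => simp [y0]
  | one => simp [y1]
  | more n h1 h2 =>
    simp only [yr, eval_add, eval_mul, eval_C, eval_X, h1, h2]
    ring

theorem y_coeff_zero {F : Type*} [Field F] (w : ℕ → F) (y : ℕ → F[X])
    (y0 : y 0 = 1)
    (yr : ∀ n, y (n + 2) = C (w (n + 2)) * X * y (n + 1) + y n) (n : ℕ) :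
    (y (2 * n)).coeff 0 = 1 := by
  induction n with
  | zero => simp [y0]
  | succ n ih =>
    rw [show 2 * (n + 1) = 2 * n + 2 by ring, yr, coeff_add, ih]
    simp [mul_coeff_zero]

/-- identification of the two continuants -/
theorem ident (p k : ℕ) [Fact (Nat.Prime p)] (hodd : Odd p)
    (hk1 : 1 ≤ k) (hk2 : 2 * k < p)
    (ω : ZMod p)
    (hω : ω = (-1) ^ (k - 1) * ∏ i ∈ Finset.Icc 1 k, (1 - (2 * (i : ZMod p))⁻¹))
    (w : ℕ → ZMod p)
    (hwne : ∀ i, 1 ≤ i → i ≤ 2 * k → w i ≠ 0)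
    (hw1 : w 1 = (2 * (k : ZMod p) - 1) * (2 * (k : ZMod p) * ω)⁻¹)
    (hwrec : ∀ i, 1 ≤ i → i ≤ 2 * k - 1 →
      w (i + 1) * w i =
        (2 * (k : ZMod p) - 2 * (i : ZMod p) - 1) * (2 * (k : ZMod p) - 2 * (i : ZMod p) + 1)
          * ((i : ZMod p) * (2 * (k : ZMod p) - (i : ZMod p)))⁻¹)
    (y : ℕ → (ZMod p)[X])
    (y0 : y 0 = 1) (y1 : y 1 = C (w 1) * X)
    (yr : ∀ n, y (n + 2) = C (w (n + 2)) * X * y (n + 1) + y n) :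
    y (2 * k) = C ((-1) ^ k) * Pk p k ∧ y (2 * k - 1) = C ((-1) ^ (k + 1)) * Rk p k := by
  have hnat : ∀ n : ℕ, 1 ≤ n → n < p → (n : ZMod p) ≠ 0 := by
    intro n h1 h2 h
    rw [ZMod.natCast_eq_zero_iff] at h
    exact absurd (Nat.le_of_dvd (by omega) h) (by omega)
  have h2ne : (2 : ZMod p) ≠ 0 := by exact_mod_cast hnat 2 (by omega) (by omega)
  have hne : ∀ m, m + 1 ≤ 2 * k → (2 * (m : ZMod p) + 1 - 2 * k) ≠ 0 := by
    intro m hm h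
    rcases le_total (2 * k) (2 * m + 1) with hh | hh
    · apply hnat (2 * m + 1 - 2 * k) (by omega) (by omega)
      rw [Nat.cast_sub hh]; push_cast; exact h
    · apply hnat (2 * k - (2 * m + 1)) (by omega) (by omega)
      rw [Nat.cast_sub hh]; push_cast; linear_combination -h
  have hk2m : ∀ m, m + 1 < 2 * k → (2 * (k : ZMod p) - m - 1) ≠ 0 := by
    intro m hm h
    apply hnat (2 * k - (m + 1)) (by omega) (by omega)
    rw [Nat.cast_sub hm.le]; push_cast; linear_combination h
  have hm1 : ∀ m, m + 1 < p → ((m : ZMod p) + 1) ≠ 0 := by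
    intro m hm
    exact_mod_cast hnat (m + 1) (by omega) hm
  have hrec : ∀ m, m + 2 ≤ 2 * k → w (m + 2) * w (m + 1) * (((m : ZMod p) + 1) * (2 * k - m - 1))
      = (2 * k - 2 * m - 3) * (2 * k - 2 * m - 1) := by
    intro m hm
    have h := hwrec (m + 1) (by omega) (by omega)
    rw [show m + 1 + 1 = m + 2 from rfl] at h
    have hc : ((m : ZMod p) + 1) * (2 * k - m - 1) ≠ 0 :=
      mul_ne_zero (hm1 m (by omega)) (hk2m m (by omega))
    push_cast at h
    rw [show (2 * (k : ZMod p) - (m + 1)) = 2 * k - m - 1 by ring] at h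
    rw [h, mul_assoc, inv_mul_cancel₀ hc]
    ring
  have ode := ode_pair k w y hwne hne hrec y0 y1 yr
  have hdeg := y_natDegree w y y0 y1 yr
  obtain ⟨hA, hB⟩ := ode (2 * k - 1) (by omega)
  have hkk : 2 * k - 1 + 1 = 2 * k := by omega
  rw [hkk] at hA hB
  rw [show ((2 * k - 1 : ℕ) : (ZMod p)[X]) = 2 * k - 1 by
    rw [Nat.cast_sub (by omega)]; push_cast; ring] at hA hB
  have hkne' : (2 * (k : (ZMod p)[X]) - 1) ≠ 0 := by
    have := (C_ne_zero (R := ZMod p)).mpr (hne (2 * k - 1) (by omega))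
    rw [Nat.cast_sub (by omega)] at this
    simp only [map_mul, map_add, map_sub, map_natCast, map_one, map_ofNat, Nat.cast_mul,
      Nat.cast_ofNat, Nat.cast_one] at this
    convert this using 1
    ring
  have hPdeg : (Pk p k).natDegree = 2 * k := by
    unfold Pk
    rw [natDegree_pow, show ((X : (ZMod p)[X]) ^ 2 - 1) = X ^ 2 - C 1 by simp,
      natDegree_X_pow_sub_C]
    ring
  have hPmon : (Pk p k).Monic := by
    unfold Pk
    refine Monic.pow ?_ k
    rw [show ((X : (ZMod p)[X]) ^ 2 - 1) = X ^ 2 - C 1 by simp]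
    exact monic_X_pow_sub_C _ (by norm_num)
  have hPd : derivative (Pk p k) = 2 * (k : (ZMod p)[X]) * X * (X ^ 2 - 1) ^ (k - 1) := by
    unfold Pk
    rw [derivative_pow]
    simp
    ring
  have hPs : Pk p k = (X ^ 2 - 1) * (X ^ 2 - 1) ^ (k - 1) := by
    unfold Pk
    rw [← pow_succ', Nat.sub_add_cancel hk1]
  have hy2k : y (2 * k) = C ((-1) ^ k) * Pk p k := by
    rw [← sub_eq_zero]
    apply zero_of_ode k
    · refine lt_of_le_of_lt (natDegree_sub_le _ _) (max_lt ?_ ?_)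
      · exact (hdeg _).trans_lt hk2
      · exact (natDegree_C_mul_le _ _).trans_lt (by omega)
    · rw [coeff_sub, y_coeff_zero w y y0 yr k, coeff_C_mul]
      unfold Pk
      rw [coeff_zero_eq_eval_zero]
      simp [← mul_pow]
    · have hB' : (X ^ 2 - 1) * derivative (y (2 * k)) = 2 * (k : (ZMod p)[X]) * X * y (2 * k) := by
        apply mul_left_cancel₀ hkne'
        linear_combination hB
      rw [derivative_sub, derivative_C_mul, hPd]
      rw [mul_sub, hB', hPs]
      ring
  refine ⟨hy2k, ?_⟩
  have hx21 : ((X : (ZMod p)[X]) ^ 2 - 1) ≠ 0 := by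
    rw [show ((X : (ZMod p)[X]) ^ 2 - 1) = X ^ 2 - C 1 by simp]
    exact X_pow_sub_C_ne_zero (by norm_num) _
  -- derivative of `y (2k-1)`
  have hwk := hwne (2 * k) (by omega) le_rfl
  obtain ⟨c, hc⟩ : ∃ c, derivative (y (2 * k - 1)) = C c * (X ^ 2 - 1) ^ (k - 1) := by
    refine ⟨(w (2 * k))⁻¹ * ((2 * k - 1) * (-1) ^ k), ?_⟩
    apply mul_left_cancel₀ (C_ne_zero.mpr hwk)
    apply mul_left_cancel₀ hx21
    rw [hy2k, hPs] at hA
    have e : C (w (2 * k)) * C ((w (2 * k))⁻¹ * ((2 * k - 1) * (-1) ^ k))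
        = (2 * (k : (ZMod p)[X]) - 1) * C ((-1) ^ k) := by
      rw [← C_mul, mul_inv_cancel_left₀ hwk]
      simp only [map_mul, map_sub, map_natCast, map_one, map_ofNat]
    linear_combination hA - (X ^ 2 - 1) * (X ^ 2 - 1) ^ (k - 1) * e
  -- facts about `R_k`
  have hRdeg : (Rk p k).natDegree < 2 * k := by
    rw [← hPdeg]
    exact natDegree_modByMonic_lt _ hPmon (fun h => by rw [h] at hPdeg; simp at hPdeg; omega)
  have hRdiv : Rk p k = X ^ p - Pk p k * (X ^ p /ₘ Pk p k) := by
    unfold Rk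
    exact eq_sub_of_add_eq (modByMonic_add_div _ _)
  have hR1 : (Rk p k).eval 1 = 1 := by
    rw [hRdiv]; simp [Pk, show k ≠ 0 by omega]
  have hRm1 : (Rk p k).eval (-1) = -1 := by
    rw [hRdiv]; simp [Pk, show k ≠ 0 by omega, hodd.neg_one_pow]
  obtain ⟨r, hr⟩ : ∃ r, derivative (Rk p k) = C r * (X ^ 2 - 1) ^ (k - 1) := by
    have hQmon : ((X ^ 2 - 1 : (ZMod p)[X]) ^ (k - 1)).Monic := by
      refine Monic.pow ?_ _
      rw [show ((X : (ZMod p)[X]) ^ 2 - 1) = X ^ 2 - C 1 by simp]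
      exact monic_X_pow_sub_C _ (by norm_num)
    have hQdeg : ((X ^ 2 - 1 : (ZMod p)[X]) ^ (k - 1)).natDegree = 2 * (k - 1) := by
      rw [natDegree_pow, show ((X : (ZMod p)[X]) ^ 2 - 1) = X ^ 2 - C 1 by simp,
        natDegree_X_pow_sub_C]
      ring
    obtain ⟨q, hq⟩ : ∃ q, derivative (Rk p k) = (X ^ 2 - 1) ^ (k - 1) * q := by
      set A := (X ^ p /ₘ Pk p k : (ZMod p)[X])
      refine ⟨-(2 * (k : (ZMod p)[X]) * X * A + (X ^ 2 - 1) * derivative A), ?_⟩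
      rw [hRdiv, derivative_sub, derivative_mul, hPd, hPs, derivative_X_pow]
      simp
      ring
    have hq0 : q.natDegree = 0 := by
      by_cases hqz : q = 0
      · simp [hqz]
      · have h1 := congrArg natDegree hq
        rw [hQmon.natDegree_mul' hqz, hQdeg] at h1
        have h2 := natDegree_derivative_le (Rk p k)
        omega
    refine ⟨q.coeff 0, ?_⟩
    rw [hq, ← eq_C_of_natDegree_eq_zero hq0]
    ring
  -- value of `y (2k-1)` at `1`
  have hstep : ∀ m, m + 2 ≤ 2 * k →
      ((m : ZMod p) + 1) * (y (m + 2)).eval 1 = (2 * k - m - 2) * (y m).eval 1 := by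
    intro m hm
    have b1 := congrArg (eval 1) (ode m (by omega)).2
    have b2 := congrArg (eval 1) (ode (m + 1) (by omega)).2
    simp only [eval_mul, eval_sub, eval_add, eval_pow, eval_X, eval_C, eval_one, eval_natCast,
      eval_ofNat, Nat.cast_add, Nat.cast_one] at b1 b2
    rw [show m + 1 + 1 = m + 2 from rfl] at b2
    have n1 := hne m (by omega)
    have n2 := hne (m + 1) (by omega)
    push_cast at n2
    have c1 := hm1 m (by omega)
    have c2 := hm1 (m + 1) (by omega)
    push_cast at c2
    apply mul_left_cancel₀ n1
    apply mul_left_cancel₀ n2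
    apply mul_left_cancel₀ c1
    apply mul_left_cancel₀ c2
    have h := hrec m hm
    linear_combination (-(2 * (m : ZMod p) + 1 - 2 * k) * (m + 1) ^ 2) * b2
      + ((m : ZMod p) + 1) * w (m + 2) * (m + 2) * (2 * k - m - 2) * b1
      + ((m : ZMod p) + 1) * (m + 2) * (2 * k - m - 2) * (y m).eval 1 * h
  have hval : ∀ i, i + 1 ≤ k → (y (2 * i + 1)).eval 1
      = w 1 * ∏ l ∈ Finset.range i, ((2 * k - 2 * l - 3) * (2 * ((l : ZMod p) + 1))⁻¹) := by
    intro i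
    induction i with
    | zero => intro _; simp [y1]
    | succ i ih =>
      intro hi
      rw [Finset.prod_range_succ, ← mul_assoc, ← ih (by omega)]
      have h := hstep (2 * i + 1) (by omega)
      rw [show 2 * i + 1 + 2 = 2 * (i + 1) + 1 by ring] at h
      push_cast at h
      have hn : 2 * ((i : ZMod p) + 1) ≠ 0 := mul_ne_zero h2ne (hm1 i (by omega))
      apply mul_left_cancel₀ hn
      have : 2 * ((i : ZMod p) + 1) * (2 * ((i : ZMod p) + 1))⁻¹ = 1 := mul_inv_cancel₀ hn
      linear_combination h - (eval 1 (y (2 * i + 1))) * (2 * k - 2 * i - 3) * this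
  have hy1 : (y (2 * k - 1)).eval 1 = (-1) ^ (k + 1) := by
    obtain ⟨k', rfl⟩ : ∃ k', k = k' + 1 := ⟨k - 1, by omega⟩
    have h := hval k' le_rfl
    rw [show 2 * (k' + 1) - 1 = 2 * k' + 1 by omega, h, hw1, hω]
    have e1 : ∏ l ∈ Finset.range k', ((2 * ((k' + 1 : ℕ) : ZMod p) - 2 * l - 3)
          * (2 * ((l : ZMod p) + 1))⁻¹)
        = ∏ l ∈ Finset.range k', (1 - (2 * ((l + 1 : ℕ) : ZMod p))⁻¹) := by
      rw [Finset.prod_mul_distrib]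
      have : ∏ l ∈ Finset.range k', (2 * ((k' + 1 : ℕ) : ZMod p) - 2 * l - 3)
          = ∏ l ∈ Finset.range k', (2 * (l : ZMod p) + 1) := by
        rw [← Finset.prod_range_reflect (fun l => (2 * (l : ZMod p) + 1))]
        refine Finset.prod_congr rfl fun l hl => ?_
        rw [Finset.mem_range] at hl
        rw [show k' - 1 - l = k' - (l + 1) by omega, Nat.cast_sub (by omega)]
        push_cast
        ring
      rw [this, ← Finset.prod_mul_distrib]
      refine Finset.prod_congr rfl fun l hl => ?_
      rw [Finset.mem_range] at hl
      have hn := hm1 l (by omega)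
      push_cast
      field_simp
      ring
    have e2 : ∏ i ∈ Finset.Icc 1 (k' + 1), (1 - (2 * (i : ZMod p))⁻¹)
        = (∏ l ∈ Finset.range k', (1 - (2 * ((l + 1 : ℕ) : ZMod p))⁻¹))
          * (1 - (2 * ((k' + 1 : ℕ) : ZMod p))⁻¹) := by
      rw [← Finset.prod_range_succ (fun l : ℕ => (1 - (2 * ((l + 1 : ℕ) : ZMod p))⁻¹)),
        Finset.range_eq_Ico,
        Finset.prod_Ico_add' (fun i : ℕ => (1 - (2 * (i : ZMod p))⁻¹)) 0 (k' + 1) 1]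
      rfl
    rw [e1, e2]
    have hPi : ∏ l ∈ Finset.range k', (1 - (2 * ((l + 1 : ℕ) : ZMod p))⁻¹) ≠ 0 := by
      rw [Finset.prod_ne_zero_iff]
      intro l hl
      rw [Finset.mem_range] at hl
      have hn := hm1 l (by omega)
      have hn2 := hnat (2 * l + 1) (by omega) (by omega)
      push_cast at hn2 ⊢
      intro h
      apply hn2
      field_simp at h
      linear_combination h
    set Q := ∏ l ∈ Finset.range k', (1 - (2 * ((l + 1 : ℕ) : ZMod p))⁻¹)
    have hn := hnat (k' + 1) (by omega) (by omega)
    set z := ((k' + 1 : ℕ) : ZMod p) with hz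
    have hz1 : 2 * z - 1 ≠ 0 := by
      have := hnat (2 * k' + 1) (by omega) (by omega)
      push_cast at this
      rw [hz]; push_cast
      intro h; apply this; linear_combination h
    have e3 : 2 * z * ((-1) ^ (k' + 1 - 1) * (Q * (1 - (2 * z)⁻¹)))
        = (-1) ^ k' * (Q * (2 * z - 1)) := by
      rw [Nat.add_sub_cancel]
      field_simp
    rw [e3]
    have e4 : ((-1 : ZMod p) ^ k') * (-1) ^ k' = 1 := by rw [← mul_pow]; simp
    have hneg : ((-1 : ZMod p) ^ k') ≠ 0 := by simp
    rw [pow_succ, pow_succ]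
    field_simp
    linear_combination -e4
  have hym1 : (y (2 * k - 1)).eval (-1) = -(-1) ^ (k + 1) := by
    rw [y_parity w y y0 y1 yr, hy1, (show Odd (2 * k - 1) from ⟨k - 1, by omega⟩).neg_one_pow]
    ring
  have hyd := hdeg (2 * k - 1)
  set s : ZMod p := (-1) ^ (k + 1) with hs
  set f := y (2 * k - 1) - C s * Rk p k with hf
  set d := c - s * r with hdd
  have hfd : derivative f = C d * (X ^ 2 - 1) ^ (k - 1) := by
    rw [hf, derivative_sub, derivative_C_mul, hc, hr, hdd]
    simp only [map_sub, map_mul]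
    ring
  have hfdeg : f.natDegree < p := by
    refine lt_of_le_of_lt (natDegree_sub_le _ _) (max_lt (by omega) ?_)
    exact (natDegree_C_mul_le _ _).trans_lt (by omega)
  have hf1 : f.eval 1 = 0 := by simp [hf, hy1, hR1]
  have hfm1 : f.eval (-1) = 0 := by simp [hf, hym1, hRm1]
  have hh := const_of_deriv (C d * Rk p k - C r * f) (by
      refine lt_of_le_of_lt (natDegree_sub_le _ _) (max_lt ?_ ?_)
      · exact (natDegree_C_mul_le _ _).trans_lt (by omega)
      · exact (natDegree_C_mul_le _ _).trans_lt (by omega)) (by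
      rw [derivative_sub, derivative_C_mul, derivative_C_mul, hfd, hr]; ring)
  have g1 := congrArg (eval 1) hh
  have g2 := congrArg (eval (-1)) hh
  simp only [eval_sub, eval_mul, eval_C, hR1, hRm1, hf1, hfm1] at g1 g2
  have hd0 : d = 0 := by
    apply mul_left_cancel₀ h2ne
    linear_combination g1 - g2
  have hfc := const_of_deriv f hfdeg (by rw [hfd, hd0]; simp)
  have hf0 : f = 0 := by
    rw [hfc] at hf1
    simp only [eval_C] at hf1
    rw [hfc, hf1, C_0]
  exact sub_eq_zero.mp hf0

theorem stmt_14 (p k : ℕ) [Fact (Nat.Prime p)] (hodd : Odd p)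
    (hk1 : 1 ≤ k) (hk2 : 2 * k < p)
    (ω : ZMod p)
    (hω : ω = (-1) ^ (k - 1) * ∏ i ∈ Finset.Icc 1 k, (1 - (2 * (i : ZMod p))⁻¹))
    (w : ℕ → ZMod p)
    (hwne : ∀ i, 1 ≤ i → i ≤ 2 * k → w i ≠ 0)
    (hw1 : w 1 = (2 * (k : ZMod p) - 1) * (2 * (k : ZMod p) * ω)⁻¹)
    (hwrec : ∀ i, 1 ≤ i → i ≤ 2 * k - 1 →
      w (i + 1) * w i =
        (2 * (k : ZMod p) - 2 * (i : ZMod p) - 1) * (2 * (k : ZMod p) - 2 * (i : ZMod p) + 1)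
          * ((i : ZMod p) * (2 * (k : ZMod p) - (i : ZMod p)))⁻¹)
    -- the continuants `K_{n,m} = ⟨w_n T, …, w_m T⟩`
    (K : ℕ → ℕ → Polynomial (ZMod p))
    (hK : ∀ n m, K n m = cont ((List.range (m + 1 - n)).map fun i => C (w (n + i)) * X))
    -- the polynomial `H(V)` for `V = [p, k, j, ε]`
    (H : ℕ → ZMod p → Polynomial (Polynomial (ZMod p)))
    (hH : ∀ j ε, H j ε
      = C (K (j + 2) (2 * k)) * X ^ (p + 1) - C (K (j + 1) (2 * k)) * X ^ p
        + C (C ε) * (C (K 1 j) * X + C (K 1 (j - 1))))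
    (j : ℕ) (hj1 : 1 ≤ j) (hj2 : j ≤ 2 * k - 1) (ε : ZMod p) (hε : ε ≠ 0)
    -- `α = [w_{j+1}T, …, w_{2k}T, α_{2k-j+1}]`, an infinite continued fraction with
    -- complete quotients `αs` (`α = αs 1`), and `α^p = ε(-1)^{k+j}(P_k α_{2k-j+1} - R_k)`
    (α : LaurentSeries (ZMod p)) (αs : ℕ → LaurentSeries (ZMod p)) (hα1 : αs 1 = α)
    (hord : ∀ n, 1 ≤ n → (αs n).order < 0)
    (hinit : ∀ i, 1 ≤ i → i ≤ 2 * k - j →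
      αs i = aeval (Tinv (ZMod p)) (C (w (j + i)) * X) + (αs (i + 1))⁻¹)
    (htail : ∀ n, 2 * k - j < n → ∃ b : Polynomial (ZMod p),
      0 < b.degree ∧ αs n = aeval (Tinv (ZMod p)) b + (αs (n + 1))⁻¹)
    (heq : α ^ p
      = algebraMap (ZMod p) (LaurentSeries (ZMod p)) (ε * (-1) ^ (k + j))
        * (aeval (Tinv (ZMod p)) (Pk p k) * αs (2 * k - j + 1)
            - aeval (Tinv (ZMod p)) (Rk p k))) :
    Polynomial.eval₂
      ((aeval (Tinv (ZMod p)) : Polynomial (ZMod p) →ₐ[ZMod p] LaurentSeries (ZMod p)) :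
        Polynomial (ZMod p) →+* LaurentSeries (ZMod p))
      α (H j ε) = 0 := by
  subst hα1
  have hKr : ∀ n, K 1 (n + 2) = C (w (n + 2)) * X * K 1 (n + 1) + K 1 n := by
    intro n
    rw [hK, hK, hK, show n + 2 + 1 - 1 = n + 2 by omega, show n + 1 + 1 - 1 = n + 1 by omega,
      show n + 1 - 1 = n by omega, cont_right]
    rw [show 1 + (n + 1) = n + 2 by ring]
  have hK0 : K 1 0 = 1 := by rw [hK]; simp [cont]
  have hK1 : K 1 1 = C (w 1) * X := by rw [hK]; simp [cont]
  obtain ⟨hP, hR⟩ := ident p k hodd hk1 hk2 ω hω w hwne hw1 hwrec (fun n => K 1 n) hK0 hK1 hKr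
  have hKl : ∀ n, n + 1 ≤ 2 * k → K n (2 * k)
      = C (w n) * X * K (n + 1) (2 * k) + K (n + 2) (2 * k) := by
    intro n hn
    obtain ⟨M, hM⟩ : ∃ M, 2 * k = n + 1 + M := ⟨2 * k - (n + 1), by omega⟩
    rw [hK, hK, hK, hM, show n + 1 + M + 1 - n = M + 2 by omega,
      show n + 1 + M + 1 - (n + 1) = M + 1 by omega, show n + 1 + M + 1 - (n + 2) = M by omega]
    exact cont_left (fun i => C (w i) * X) n M
  have hKe : K (2 * k + 1) (2 * k) = 1 := by rw [hK]; simp [cont]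
  have hKe' : K (2 * k) (2 * k) = C (w (2 * k)) * X := by
    rw [hK, show 2 * k + 1 - 2 * k = 1 by omega]; simp [cont]
  set φ : (ZMod p)[X] →ₐ[ZMod p] LaurentSeries (ZMod p) := aeval (Tinv (ZMod p)) with hφ
  have hne : ∀ n, 1 ≤ n → αs n ≠ 0 := by
    intro n hn h
    have := hord n hn
    rw [h] at this
    simp at this
  set β := αs (2 * k - j + 1) with hβ
  set E := φ (K 1 (2 * k)) * β + φ (K 1 (2 * k - 1)) with hE
  have main : ∀ t, t + 1 ≤ 2 * k - j →
      E * (φ (K (2 * k - t + 1) (2 * k)) * αs (2 * k - j - t) - φ (K (2 * k - t) (2 * k)))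
        = (-1) ^ t * (φ (K 1 (2 * k - t - 1)) * αs (2 * k - j - t)
            + φ (K 1 (2 * k - t - 2))) := by
    intro t
    induction t with
    | zero =>
      intro _
      have h := hinit (2 * k - j) (by omega) le_rfl
      rw [show j + (2 * k - j) = 2 * k by omega, ← hβ] at h
      have hb : β * β⁻¹ = 1 := mul_inv_cancel₀ (hne _ (by omega))
      have hk' := hKr (2 * k - 2)
      rw [show 2 * k - 2 + 2 = 2 * k by omega, show 2 * k - 2 + 1 = 2 * k - 1 by omega] at hk'
      simp only [Nat.sub_zero, pow_zero]
      rw [h, hKe, hKe', hE, hk']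
      simp only [map_add, map_mul, map_one]
      linear_combination (φ (C (w (2 * k))) * φ X * φ (K 1 (2 * k - 1)) + φ (K 1 (2 * k - 2))) * hb
    | succ t ih =>
      intro ht
      have IH := ih (by omega)
      have h := hinit (2 * k - j - (t + 1)) (by omega) (by omega)
      rw [show j + (2 * k - j - (t + 1)) = 2 * k - (t + 1) by omega,
        show 2 * k - j - (t + 1) + 1 = 2 * k - j - t by omega] at h
      have hb : αs (2 * k - j - t) * (αs (2 * k - j - t))⁻¹ = 1 :=
        mul_inv_cancel₀ (hne _ (by omega))
      set x := αs (2 * k - j - t)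
      have hk' := hKr (2 * k - (t + 1) - 2)
      rw [show 2 * k - (t + 1) - 2 + 2 = 2 * k - (t + 1) by omega,
        show 2 * k - (t + 1) - 2 + 1 = 2 * k - (t + 1) - 1 by omega] at hk'
      have hl := hKl (2 * k - (t + 1)) (by omega)
      rw [show 2 * k - (t + 1) + 1 = 2 * k - t by omega,
        show 2 * k - (t + 1) + 2 = 2 * k - t + 1 by omega] at hl
      rw [show 2 * k - t - 1 = 2 * k - (t + 1) by omega,
        show 2 * k - t - 2 = 2 * k - (t + 1) - 1 by omega, hk'] at IH
      rw [show 2 * k - (t + 1) + 1 = 2 * k - t by omega, hl, h]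
      simp only [map_add, map_mul] at IH ⊢
      linear_combination (-x⁻¹) * IH + (E * φ (K (2 * k - t + 1) (2 * k))
        - (-1) ^ t * (φ (C (w (2 * k - (t + 1)))) * φ X * φ (K 1 (2 * k - (t + 1) - 1))
          + φ (K 1 (2 * k - (t + 1) - 2)))) * hb
  have hfin := main (2 * k - j - 1) (by omega)
  rw [show 2 * k - (2 * k - j - 1) + 1 = j + 2 by omega,
    show 2 * k - (2 * k - j - 1) = j + 1 by omega,
    show 2 * k - j - (2 * k - j - 1) = 1 by omega,
    show j + 1 - 1 = j by omega, show j + 1 - 2 = j - 1 by omega] at hfin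
  have hsg : ((-1 : LaurentSeries (ZMod p)) ^ j) * (-1) ^ (2 * k - j - 1) = -1 := by
    rw [← pow_add, show j + (2 * k - j - 1) = 2 * k - 1 by omega,
      (show Odd (2 * k - 1) from ⟨k - 1, by omega⟩).neg_one_pow]
  have hEE : αs 1 ^ p = algebraMap (ZMod p) (LaurentSeries (ZMod p)) ε * (-1) ^ j * E := by
    rw [heq, hE, show K 1 (2 * k) = _ from hP, show K 1 (2 * k - 1) = _ from hR]
    have hkk : ((-1 : LaurentSeries (ZMod p)) ^ k) = (-1) ^ k := rfl
    simp only [map_mul, map_pow, map_neg, map_one]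
    ring
  have hCε : φ (C ε) = algebraMap (ZMod p) (LaurentSeries (ZMod p)) ε := by
    rw [hφ, aeval_C]
  rw [hH]
  simp only [eval₂_add, eval₂_sub, eval₂_mul, eval₂_C, eval₂_X, eval₂_pow, RingHom.coe_coe]
  rw [pow_succ, hEE, hCε]
  linear_combination algebraMap (ZMod p) (LaurentSeries (ZMod p)) ε * (-1) ^ j * hfin
    + algebraMap (ZMod p) (LaurentSeries (ZMod p)) ε
      * (φ (K 1 j) * αs 1 + φ (K 1 (j - 1))) * hsg
end
end
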